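/- arXiv:1810.10742 — 3 statements merged into one kernel-verified Lean document; each statement's English description precedes it below -/
import Mathlib

section
/- Let f_α be the intermittent map with α ≥ 1. Then for Lebesgue-almost every x ∈ S¹: lim_{n→∞} ξ_n^{(1)}(x)/log_2 n = 1/α, and lim_{n→∞} log ξ_n^{(0)}(x)/log n = 1. -/
open MeasureTheory Filter Set Real

noncomputable section

/-- The Liverani–Saussol–Vaienti intermittent map on `S¹ = [0,1)`:
`f_α(x) = x(1 + 2^α x^α)` for `x < 1/2` and `f_α(x) = 2x − 1` for `x ≥ 1/2`. -/
def lsv (a : ℝ) (x : ℝ) : ℝ :=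
  if x < 1 / 2 then x * (1 + 2 ^ a * x ^ a) else 2 * x - 1

/-- The circle distance on `S¹ = [0,1)`: `d(x,y) = min(|x−y|, 1−|x−y|)`. -/
def circDist (x y : ℝ) : ℝ := min |x - y| (1 - |x - y|)

/-- Maximum process `M_n(x) = max_{0 ≤ k ≤ n-1} φ(f^k x)`. -/
def maxProc {X : Type*} (f : X → X) (φ : X → ℝ) (n : ℕ) (x : X) : ℝ :=
  ⨆ k : Fin n, φ (f^[k] x)

/-- Dynamical run length: the longest run `ξ_n(x)`, within time `n`, of
consecutive visits of the orbit of `x` to the set `A`. -/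
def runLen (f : ℝ → ℝ) (A : Set ℝ) (n : ℕ) (x : ℝ) : ℕ :=
  sSup {k : ℕ | k ≤ n ∧ ∃ i : ℕ, i + k ≤ n ∧ ∀ m < k, f^[i + m] x ∈ A}

namespace LSV

variable {a : ℝ}

/-- derivative of the map -/
def dlsv (a : ℝ) (x : ℝ) : ℝ := if x < 1 / 2 then 1 + (1 + a) * (2 ^ a * x ^ a) else 2

/-- derivative cocycle -/
def D (a : ℝ) (n : ℕ) (x : ℝ) : ℝ := ∏ i ∈ Finset.range n, dlsv a ((lsv a)^[i] x)

/-- cylinder sets -/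
def Cyl (a : ℝ) (n : ℕ) (b : ℕ → Prop) : Set ℝ :=
  {x | x ∈ Ico (0 : ℝ) 1 ∧ ∀ i < n, ((lsv a)^[i] x < 1 / 2 ↔ b i)}

lemma lsv_left {x : ℝ} (h : x < 1 / 2) : lsv a x = x * (1 + 2 ^ a * x ^ a) := if_pos h
lemma lsv_right {x : ℝ} (h : ¬ x < 1 / 2) : lsv a x = 2 * x - 1 := if_neg h

lemma two_pow_half : (2 : ℝ) ^ a * (1 / 2) ^ a = 1 := by
  rw [← mul_rpow (by norm_num) (by norm_num)]; norm_num

lemma qlt (ha : 1 ≤ a) {x : ℝ} (h0 : 0 ≤ x) (h : x < 1 / 2) : (2 : ℝ) ^ a * x ^ a < 1 := by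
  rw [← two_pow_half (a := a)]
  have := rpow_lt_rpow h0 h (by linarith : 0 < a)
  have h2 : (0 : ℝ) < 2 ^ a := by positivity
  exact mul_lt_mul_of_pos_left this h2

lemma qmono (ha : 1 ≤ a) {x y : ℝ} (h0 : 0 ≤ x) (h : x ≤ y) :
    (2 : ℝ) ^ a * x ^ a ≤ 2 ^ a * y ^ a := by
  have := rpow_le_rpow h0 h (by linarith : 0 ≤ a)
  gcongr

lemma lsv_mem (ha : 1 ≤ a) {x : ℝ} (hx : x ∈ Ico (0 : ℝ) 1) : lsv a x ∈ Ico (0 : ℝ) 1 := by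
  obtain ⟨h0, h1⟩ := hx
  by_cases h : x < 1 / 2
  · rw [lsv_left h]
    have := qlt ha h0 h
    have h3 : 0 ≤ (2 : ℝ) ^ a * x ^ a := by positivity
    constructor
    · positivity
    · nlinarith
  · rw [lsv_right h]; constructor <;> linarith

lemma iter_mem (ha : 1 ≤ a) {x : ℝ} (hx : x ∈ Ico (0 : ℝ) 1) (n : ℕ) :
    (lsv a)^[n] x ∈ Ico (0 : ℝ) 1 := by
  induction n with
  | zero => simpa
  | succ n ih => rw [Function.iterate_succ_apply']; exact lsv_mem ha ih

lemma lsv_zero : lsv a 0 = 0 := by rw [lsv_left (by norm_num)]; ring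

lemma measurable_lsv : Measurable (lsv a) := by
  unfold lsv
  refine Measurable.ite measurableSet_Iio ?_ ?_ <;> fun_prop

lemma measurable_dlsv : Measurable (dlsv a) := by
  unfold dlsv
  refine Measurable.ite measurableSet_Iio ?_ ?_ <;> fun_prop

lemma measurable_iter (n : ℕ) : Measurable ((lsv a)^[n]) := measurable_lsv.iterate n

lemma measurable_D (n : ℕ) : Measurable (D a n) := by
  unfold D
  exact Finset.measurable_prod _ fun i _ => measurable_dlsv.comp (measurable_iter i)

lemma one_le_dlsv (ha : 1 ≤ a) {x : ℝ} (h0 : 0 ≤ x) : 1 ≤ dlsv a x := by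
  unfold dlsv; split_ifs
  · have : 0 ≤ (1 + a) * ((2 : ℝ) ^ a * x ^ a) := by positivity
    linarith
  · norm_num

lemma one_le_D (ha : 1 ≤ a) {x : ℝ} (hx : x ∈ Ico (0 : ℝ) 1) (n : ℕ) : 1 ≤ D a n x := by
  induction n with
  | zero => simp [D]
  | succ n ih =>
    have := one_le_dlsv ha (iter_mem ha hx n).1
    rw [D, Finset.prod_range_succ, ← D]
    nlinarith

lemma D_succ (n : ℕ) (x : ℝ) : D a (n + 1) x = D a n x * dlsv a ((lsv a)^[n] x) := by
  rw [D, Finset.prod_range_succ, ← D]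

lemma cyl_succ (n : ℕ) (b : ℕ → Prop) (x : ℝ) :
    x ∈ Cyl a (n + 1) b ↔ x ∈ Cyl a n b ∧ ((lsv a)^[n] x < 1 / 2 ↔ b n) := by
  simp only [Cyl, mem_ofPred_eq, Nat.forall_lt_succ_right]
  tauto

lemma measurable_cyl (n : ℕ) (b : ℕ → Prop) : MeasurableSet (Cyl a n b) := by
  induction n with
  | zero =>
    have : Cyl a 0 b = Ico (0 : ℝ) 1 := by ext x; simp [Cyl]
    rw [this]; exact measurableSet_Ico
  | succ n ih =>
    have : Cyl a (n + 1) b = Cyl a n b ∩ {x | (lsv a)^[n] x < 1 / 2 ↔ b n} := by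
      ext x; exact cyl_succ n b x
    rw [this]
    refine ih.inter ?_
    by_cases h : b n
    · simp only [h, iff_true]; exact measurableSet_lt (measurable_iter n) measurable_const
    · simp only [h, iff_false, not_lt]; exact measurableSet_le measurable_const (measurable_iter n)

/-- one-step properties on a branch -/
lemma lsv_strictMono_branch (ha : 1 ≤ a) {x y : ℝ} (h0 : 0 ≤ x) (hxy : x < y)
    (hb : x < 1 / 2 ↔ y < 1 / 2) : lsv a x < lsv a y := by
  by_cases h : x < 1 / 2
  · rw [lsv_left h, lsv_left (hb.1 h)]
    have := qmono ha h0 hxy.le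
    have h3 : 0 ≤ (2 : ℝ) ^ a * x ^ a := by positivity
    nlinarith
  · rw [lsv_right h, lsv_right (fun h' => h (hb.2 h'))]; linarith

lemma dlsv_mono_branch (ha : 1 ≤ a) {x y : ℝ} (h0 : 0 ≤ x) (hxy : x ≤ y)
    (hb : x < 1 / 2 ↔ y < 1 / 2) : dlsv a x ≤ dlsv a y := by
  unfold dlsv
  by_cases h : x < 1 / 2
  · rw [if_pos h, if_pos (hb.1 h)]
    have := qmono ha h0 hxy
    nlinarith
  · rw [if_neg h, if_neg (fun h' => h (hb.2 h'))]

lemma aux_anti (ha : 1 ≤ a) {p q : ℝ} (hp : 0 ≤ p) (hpq : p ≤ q) :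
    (1 + (1 + a) * q) * (1 + p) ^ (a + 1) ≤ (1 + (1 + a) * p) * (1 + q) ^ (a + 1) := by
  -- Bernoulli for ((1+q)/(1+p))^(a+1)
  have h1p : 0 < 1 + p := by linarith
  have key := one_add_mul_self_le_rpow_one_add (s := (q - p) / (1 + p)) (p := a + 1)
    (by have : 0 ≤ (q - p) / (1 + p) := div_nonneg (by linarith) h1p.le
        linarith) (by linarith)
  have e : 1 + (q - p) / (1 + p) = (1 + q) / (1 + p) := by field_simp; ring
  rw [e, div_rpow (by linarith) h1p.le, le_div_iff₀ (by positivity)] at key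
  have hP : 0 < (1 + p) ^ (a + 1) := by positivity
  have h2 : (1 + (1 + a) * q) ≤ (1 + (1 + a) * p) * (1 + (a + 1) * ((q - p) / (1 + p))) := by
    have e2 : (1 + (1 + a) * p) * (1 + (a + 1) * ((q - p) / (1 + p))) - (1 + (1 + a) * q)
      = (1 + a) * (q - p) * ((1 + (1 + a) * p) / (1 + p) - 1) := by field_simp; ring
    have h3 : 1 ≤ (1 + (1 + a) * p) / (1 + p) := by rw [le_div_iff₀ h1p]; nlinarith
    have : 0 ≤ (1 + a) * (q - p) * ((1 + (1 + a) * p) / (1 + p) - 1) := by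
      apply mul_nonneg (mul_nonneg (by linarith) (by linarith)) (by linarith)
    linarith
  have h4 : 0 ≤ 1 + (1 + a) * p := by positivity
  calc _ ≤ (1 + (1 + a) * p) * (1 + (a + 1) * ((q - p) / (1 + p))) * (1 + p) ^ (a + 1) := by
        gcongr
    _ = (1 + (1 + a) * p) * ((1 + (a + 1) * ((q - p) / (1 + p))) * (1 + p) ^ (a + 1)) := by ring
    _ ≤ _ := by gcongr

lemma W_branch (ha : 1 ≤ a) {x y : ℝ} (h0 : 0 ≤ x) (hxy : x ≤ y)
    (hb : x < 1 / 2 ↔ y < 1 / 2) :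
    dlsv a y * y ^ (a + 1) * (lsv a x) ^ (a + 1) ≤ dlsv a x * x ^ (a + 1) * (lsv a y) ^ (a + 1) := by
  have hy0 : 0 ≤ y := h0.trans hxy
  by_cases h : x < 1 / 2
  · have h' := hb.1 h
    rw [lsv_left h, lsv_left h', dlsv, dlsv, if_pos h, if_pos h']
    have hp : 0 ≤ (2 : ℝ) ^ a * x ^ a := by positivity
    have hq : 0 ≤ (2 : ℝ) ^ a * y ^ a := by positivity
    rw [mul_rpow h0 (by linarith), mul_rpow hy0 (by linarith)]
    have := aux_anti ha hp (qmono ha h0 hxy)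
    have hx : 0 ≤ x ^ (a + 1) * y ^ (a + 1) := by positivity
    nlinarith [mul_le_mul_of_nonneg_left this hx]
  · have h' : ¬ y < 1 / 2 := fun h' => h (hb.2 h')
    rw [lsv_right h, lsv_right h', dlsv, dlsv, if_neg h, if_neg h', mul_assoc, mul_assoc,
      ← mul_rpow hy0 (by linarith), ← mul_rpow h0 (by linarith)]
    have : (y * (2 * x - 1)) ^ (a + 1) ≤ (x * (2 * y - 1)) ^ (a + 1) := by
      apply rpow_le_rpow _ (by nlinarith) (by linarith)
      apply mul_nonneg hy0; linarith
    linarith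

lemma cyl_strictMono (ha : 1 ≤ a) (n : ℕ) (b : ℕ → Prop) {x y : ℝ} (hx : x ∈ Cyl a n b)
    (hy : y ∈ Cyl a n b) (hxy : x < y) : (lsv a)^[n] x < (lsv a)^[n] y := by
  induction n with
  | zero => simpa
  | succ n ih =>
    rw [cyl_succ] at hx hy
    rw [Function.iterate_succ_apply', Function.iterate_succ_apply']
    exact lsv_strictMono_branch ha (iter_mem ha hx.1.1 n).1 (ih hx.1 hy.1) (hx.2.trans hy.2.symm)

lemma cyl_mono (ha : 1 ≤ a) (n : ℕ) (b : ℕ → Prop) {x y : ℝ} (hx : x ∈ Cyl a n b)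
    (hy : y ∈ Cyl a n b) (hxy : x ≤ y) : (lsv a)^[n] x ≤ (lsv a)^[n] y := by
  rcases hxy.eq_or_lt with h | h
  · rw [h]
  · exact (cyl_strictMono ha n b hx hy h).le

lemma D_mono (ha : 1 ≤ a) (n : ℕ) (b : ℕ → Prop) {x y : ℝ} (hx : x ∈ Cyl a n b)
    (hy : y ∈ Cyl a n b) (hxy : x ≤ y) : D a n x ≤ D a n y := by
  induction n with
  | zero => simp [D]
  | succ n ih =>
    rw [cyl_succ] at hx hy
    rw [D_succ, D_succ]
    have h1 := ih hx.1 hy.1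
    have h2 := dlsv_mono_branch ha (iter_mem ha hx.1.1 n).1 (cyl_mono ha n b hx.1 hy.1 hxy)
      (hx.2.trans hy.2.symm)
    have h3 := one_le_D ha hx.1.1 n
    have h4 := one_le_dlsv ha (iter_mem ha hx.1.1 n).1
    apply mul_le_mul h1 h2 <;> linarith

lemma D_W (ha : 1 ≤ a) (n : ℕ) (b : ℕ → Prop) {x y : ℝ} (hx : x ∈ Cyl a n b)
    (hy : y ∈ Cyl a n b) (hxy : x ≤ y) :
    D a n y * y ^ (a + 1) * ((lsv a)^[n] x) ^ (a + 1) ≤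
      D a n x * x ^ (a + 1) * ((lsv a)^[n] y) ^ (a + 1) := by
  induction n with
  | zero => simp [D]; linarith
  | succ n ih =>
    rw [cyl_succ] at hx hy
    rw [D_succ, D_succ, Function.iterate_succ_apply', Function.iterate_succ_apply']
    have h1 := ih hx.1 hy.1
    have h2 := W_branch ha (iter_mem ha hx.1.1 n).1 (cyl_mono ha n b hx.1 hy.1 hxy)
      (hx.2.trans hy.2.symm)
    have hm := cyl_mono ha n b hx.1 hy.1 hxy
    have hX := iter_mem ha hx.1.1 n
    have hY := iter_mem ha hy.1.1 n
    have hX' := (lsv_mem ha hX).1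
    have hY' := (lsv_mem ha hY).1
    have d1 := one_le_D ha hx.1.1 n
    have d2 := one_le_D ha hy.1.1 n
    have d3 := one_le_dlsv ha hX.1
    have d4 := one_le_dlsv ha hY.1
    have x0 := hx.1.1.1
    have y0 := hy.1.1.1
    generalize (lsv a)^[n] x = X at *
    generalize (lsv a)^[n] y = Y at *
    rcases hX.1.eq_or_lt with h | h
    · rw [← h, lsv_zero, zero_rpow (by linarith)]
      have d5 : 0 ≤ dlsv a 0 := by rw [h]; linarith
      have : 0 ≤ D a n x * dlsv a 0 * x ^ (a + 1) * lsv a Y ^ (a + 1) := by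
        positivity
      simpa using this
    · have hYp : 0 < Y := by linarith
      have hXb : 0 < X ^ (a + 1) := by positivity
      have hYb : 0 < Y ^ (a + 1) := by positivity
      have := mul_le_mul h1 h2 (by positivity) (by positivity)
      refine le_of_mul_le_mul_right ?_ (mul_pos hXb hYb)
      calc _ = _ := by ring
        _ ≤ _ := this
        _ = _ := by ring

lemma distortion (ha : 1 ≤ a) (n : ℕ) (b : ℕ → Prop) (hb : ¬ b n) {x y : ℝ}
    (hx : x ∈ Cyl a (n + 1) b) (hy : y ∈ Cyl a (n + 1) b) :
    D a (n + 1) y ≤ 2 ^ (a + 1) * D a (n + 1) x := by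
  have h2 : (1 : ℝ) ≤ 2 ^ (a + 1) := one_le_rpow (by norm_num) (by linarith)
  rcases le_total y x with h | h
  · have := D_mono ha _ b hy hx h
    have := one_le_D ha hx.1 (n + 1)
    nlinarith
  · rw [cyl_succ] at hx hy
    have hW := D_W ha n b hx.1 hy.1 h
    have hX : ¬ (lsv a)^[n] x < 1 / 2 := by rw [hx.2]; exact hb
    have hY : ¬ (lsv a)^[n] y < 1 / 2 := by rw [hy.2]; exact hb
    rw [D_succ, D_succ, dlsv, dlsv, if_neg hX, if_neg hY]
    have d1 := one_le_D ha hx.1.1 n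
    have d2 := one_le_D ha hy.1.1 n
    have hY1 := (iter_mem ha hy.1.1 n)
    have x0 : 0 < x := by
      rcases hx.1.1.1.eq_or_lt with h | h
      · exfalso; apply hX
        rw [← h, Function.iterate_fixed lsv_zero]; norm_num
      · exact h
    generalize (lsv a)^[n] x = X at *
    generalize (lsv a)^[n] y = Y at *
    have a1 : x ^ (a + 1) ≤ y ^ (a + 1) := rpow_le_rpow x0.le h (by linarith)
    have a2 : Y ^ (a + 1) ≤ 1 := rpow_le_one hY1.1 hY1.2.le (by linarith)
    have a3 : 1 ≤ 2 ^ (a + 1) * X ^ (a + 1) := by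
      rw [← mul_rpow (by norm_num) (by linarith)]
      exact one_le_rpow (by linarith) (by linarith)
    have xb : 0 < x ^ (a + 1) := by positivity
    have Xb : 0 ≤ X ^ (a + 1) := rpow_nonneg (by linarith) _
    have s1 : x ^ (a + 1) * (D a n y * X ^ (a + 1)) ≤ x ^ (a + 1) * D a n x := by
      calc _ = D a n y * x ^ (a + 1) * X ^ (a + 1) := by ring
        _ ≤ D a n y * y ^ (a + 1) * X ^ (a + 1) := by gcongr
        _ ≤ _ := hW
        _ ≤ D a n x * x ^ (a + 1) * 1 := by gcongr
        _ = _ := by ring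
    have s2 := le_of_mul_le_mul_left s1 xb
    have s3 : D a n y ≤ 2 ^ (a + 1) * D a n x := by
      calc D a n y = D a n y * 1 := by ring
        _ ≤ D a n y * (2 ^ (a + 1) * X ^ (a + 1)) := by gcongr
        _ = 2 ^ (a + 1) * (D a n y * X ^ (a + 1)) := by ring
        _ ≤ _ := by gcongr
    linarith

lemma branch_surj (ha : 1 ≤ a) (c : Prop) {y : ℝ} (hy : y ∈ Ico (0 : ℝ) 1) :
    ∃ z ∈ Ico (0 : ℝ) 1, (z < 1 / 2 ↔ c) ∧ lsv a z = y := by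
  by_cases hc : c
  · have hcont : Continuous (fun x : ℝ => x * (1 + 2 ^ a * x ^ a)) := by
      have := continuous_rpow_const (q := a) (by linarith)
      fun_prop
    have := intermediate_value_Ico (by norm_num : (0 : ℝ) ≤ 1 / 2) hcont.continuousOn
    rw [two_pow_half] at this
    norm_num at this
    obtain ⟨z, hz, h⟩ := this hy
    have hz2 : z < 1 / 2 := hz.2
    refine ⟨z, ⟨hz.1, by linarith⟩, ⟨fun _ => hc, fun _ => hz2⟩, ?_⟩
    rw [lsv_left hz2]; exact h
  · refine ⟨(y + 1) / 2, ⟨by linarith [hy.1], by linarith [hy.2]⟩, ?_, ?_⟩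
    · simp only [hc, iff_false]; linarith [hy.1]
    · rw [lsv_right (by linarith [hy.1])]; ring

lemma cyl_surj (ha : 1 ≤ a) (n : ℕ) (b : ℕ → Prop) {y : ℝ} (hy : y ∈ Ico (0 : ℝ) 1) :
    ∃ x ∈ Cyl a n b, (lsv a)^[n] x = y := by
  induction n generalizing y with
  | zero => exact ⟨y, by simpa [Cyl] using hy, rfl⟩
  | succ n ih =>
    obtain ⟨z, hz, hzb, hzy⟩ := branch_surj ha (b n) hy
    obtain ⟨x, hx, hxz⟩ := ih hz
    refine ⟨x, (cyl_succ n b x).2 ⟨hx, by rw [hxz]; exact hzb⟩, ?_⟩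
    rw [Function.iterate_succ_apply', hxz, hzy]

lemma lsv_hasDeriv (ha : 1 ≤ a) (c : Prop) {z : ℝ} (hz : z ∈ Ico (0 : ℝ) 1) (hc : z < 1 / 2 ↔ c) :
    HasDerivWithinAt (lsv a) (dlsv a z) {z | z ∈ Ico (0 : ℝ) 1 ∧ (z < 1 / 2 ↔ c)} z := by
  by_cases h : c
  · have hz2 := hc.2 h
    have h1 : HasDerivAt (fun x : ℝ => x * (1 + 2 ^ a * x ^ a))
        (1 * (1 + 2 ^ a * z ^ a) + z * (2 ^ a * (a * z ^ (a - 1)))) z := by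
      refine (hasDerivAt_id z).mul ?_
      exact ((hasDerivAt_rpow_const (Or.inr ha)).const_mul _).const_add _
    have e : 1 * (1 + 2 ^ a * z ^ a) + z * (2 ^ a * (a * z ^ (a - 1))) = dlsv a z := by
      rw [dlsv, if_pos hz2]
      have : z * z ^ (a - 1) = z ^ a := by
        rcases hz.1.eq_or_lt with h | h
        · rw [← h, zero_mul, zero_rpow (by linarith)]
        · rw [rpow_sub_one h.ne']; field_simp
      rw [← this]; ring
    rw [e] at h1
    refine h1.hasDerivWithinAt.congr ?_ (lsv_left hz2)
    intro x hx; exact lsv_left (hx.2.2 h)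
  · have hz2 : ¬ z < 1 / 2 := fun h' => h (hc.1 h')
    have h1 : HasDerivAt (fun x : ℝ => 2 * x - 1) (dlsv a z) z := by
      rw [dlsv, if_neg hz2]
      simpa using ((hasDerivAt_id z).const_mul 2).sub_const 1
    refine h1.hasDerivWithinAt.congr ?_ (lsv_right hz2)
    intro x hx; exact lsv_right (fun h' => h (hx.2.1 h'))

lemma cyl_hasDeriv (ha : 1 ≤ a) (n : ℕ) (b : ℕ → Prop) {x : ℝ} (hx : x ∈ Cyl a n b) :
    HasDerivWithinAt ((lsv a)^[n]) (D a n x) (Cyl a n b) x := by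
  induction n with
  | zero => simpa [D] using hasDerivWithinAt_id x _
  | succ n ih =>
    have hx' := (cyl_succ n b x).1 hx
    rw [D_succ, mul_comm, Function.iterate_succ']
    refine HasDerivWithinAt.comp x (lsv_hasDeriv ha (b n) (iter_mem ha hx.1 n) hx'.2)
      ((ih hx'.1).mono ?_) ?_
    · intro y hy; exact ((cyl_succ n b y).1 hy).1
    · intro y hy; exact ⟨iter_mem ha hy.1 n, ((cyl_succ n b y).1 hy).2⟩

end LSV

namespace LSV
variable {a : ℝ}

/-- distortion constant -/
def K (a : ℝ) : ℝ := 2 ^ (a + 1)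

lemma one_le_K (ha : 1 ≤ a) : 1 ≤ K a := one_le_rpow (by norm_num) (by linarith)

lemma distortion' (ha : 1 ≤ a) (n : ℕ) (b : ℕ → Prop) (hb : ∀ m, n = m + 1 → ¬ b m) {x y : ℝ}
    (hx : x ∈ Cyl a n b) (hy : y ∈ Cyl a n b) : D a n y ≤ K a * D a n x := by
  cases n with
  | zero => simpa [D] using one_le_K ha
  | succ n => exact distortion ha n b (hb n rfl) hx hy

lemma image_eq (ha : 1 ≤ a) (n : ℕ) (b : ℕ → Prop) (B : Set ℝ) :
    (lsv a)^[n] '' (Cyl a n b ∩ (lsv a)^[n] ⁻¹' B) = B ∩ Ico 0 1 := by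
  ext y
  constructor
  · rintro ⟨x, ⟨hx, hB⟩, rfl⟩
    exact ⟨hB, iter_mem ha hx.1 n⟩
  · rintro ⟨hB, hI⟩
    obtain ⟨x, hx, rfl⟩ := cyl_surj ha n b hI
    exact ⟨x, ⟨hx, hB⟩, rfl⟩

lemma cyl_injOn (ha : 1 ≤ a) (n : ℕ) (b : ℕ → Prop) : InjOn ((lsv a)^[n]) (Cyl a n b) := by
  intro x hx y hy h
  by_contra hne
  rcases lt_or_gt_of_ne hne with h' | h'
  · exact absurd h (cyl_strictMono ha n b hx hy h').ne
  · exact absurd h (cyl_strictMono ha n b hy hx h').ne'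

lemma vol_cov (ha : 1 ≤ a) (n : ℕ) (b : ℕ → Prop) {B : Set ℝ} (hB : MeasurableSet B) :
    ∫⁻ x in Cyl a n b ∩ (lsv a)^[n] ⁻¹' B, ENNReal.ofReal (D a n x) = volume (B ∩ Ico 0 1) := by
  have hm : MeasurableSet (Cyl a n b ∩ (lsv a)^[n] ⁻¹' B) :=
    (measurable_cyl n b).inter (measurable_iter n hB)
  have h := lintegral_image_eq_lintegral_abs_deriv_mul (f := (lsv a)^[n]) (f' := D a n) hm
    (fun x hx => (cyl_hasDeriv ha n b hx.1).mono inter_subset_left)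
    ((cyl_injOn ha n b).mono inter_subset_left) (fun _ => 1)
  rw [image_eq ha] at h
  simp only [lintegral_const, Measure.restrict_apply MeasurableSet.univ, univ_inter, one_mul, mul_one] at h
  rw [h]
  refine setLIntegral_congr_fun hm ?_
  intro x hx
  have := one_le_D ha hx.1.1 n
  simp only
  rw [abs_of_nonneg (by linarith)]

lemma cyl_bounds (ha : 1 ≤ a) (n : ℕ) (b : ℕ → Prop) (hb : ∀ m, n = m + 1 → ¬ b m) :
    ∃ d : ℝ, 0 < d ∧ ∀ B : Set ℝ, MeasurableSet B →
      volume.real (B ∩ Ico 0 1) ≤ K a * d * volume.real (Cyl a n b ∩ (lsv a)^[n] ⁻¹' B) ∧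
      d * volume.real (Cyl a n b ∩ (lsv a)^[n] ⁻¹' B) ≤ K a * volume.real (B ∩ Ico 0 1) := by
  obtain ⟨z, hz, -⟩ := cyl_surj ha n b (y := 0) (by simp)
  have hd := one_le_D ha hz.1 n
  have hK := one_le_K ha
  refine ⟨D a n z, by linarith, fun B hB => ?_⟩
  have hm : MeasurableSet (Cyl a n b ∩ (lsv a)^[n] ⁻¹' B) :=
    (measurable_cyl n b).inter (measurable_iter n hB)
  have hfin : volume (Cyl a n b ∩ (lsv a)^[n] ⁻¹' B) ≠ ⊤ := by
    refine ((measure_mono (fun x hx => hx.1.1)).trans_lt (?_ : volume (Ico (0:ℝ) 1) < ⊤)).ne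
    simp
  have hfin2 : volume (B ∩ Ico 0 1) ≠ ⊤ := by
    refine ((measure_mono inter_subset_right).trans_lt (?_ : volume (Ico (0:ℝ) 1) < ⊤)).ne
    simp
  have hc := vol_cov ha n b hB
  constructor
  · have h1 : volume (B ∩ Ico 0 1) ≤ ENNReal.ofReal (K a * D a n z) *
        volume (Cyl a n b ∩ (lsv a)^[n] ⁻¹' B) := by
      rw [← hc, ← setLIntegral_const]
      refine setLIntegral_mono' hm fun x hx => ?_
      exact ENNReal.ofReal_le_ofReal (distortion' ha n b hb hz hx.1)
    have := ENNReal.toReal_mono (ENNReal.mul_ne_top ENNReal.ofReal_ne_top hfin) h1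
    rw [ENNReal.toReal_mul, ENNReal.toReal_ofReal (by nlinarith)] at this
    exact this
  · have h1 : ENNReal.ofReal (D a n z / K a) *
        volume (Cyl a n b ∩ (lsv a)^[n] ⁻¹' B) ≤ volume (B ∩ Ico 0 1) := by
      rw [← hc, ← setLIntegral_const]
      refine setLIntegral_mono' hm fun x hx => ?_
      refine ENNReal.ofReal_le_ofReal ?_
      rw [div_le_iff₀ (by linarith), mul_comm]
      exact distortion' ha n b hb hx.1 hz
    have := ENNReal.toReal_mono hfin2 h1
    rw [ENNReal.toReal_mul, ENNReal.toReal_ofReal (div_nonneg (by linarith) (by linarith)),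
      div_mul_eq_mul_div, div_le_iff₀ (by linarith), mul_comm _ (K a)] at this
    exact this

lemma cyl_qi (ha : 1 ≤ a) (n : ℕ) (b : ℕ → Prop) (hb : ∀ m, n = m + 1 → ¬ b m)
    {B : Set ℝ} (hB : MeasurableSet B) :
    volume.real (Cyl a n b ∩ (lsv a)^[n] ⁻¹' B) ≤
      K a ^ 2 * (volume.real (Cyl a n b) * volume.real (B ∩ Ico 0 1)) ∧
    volume.real (Cyl a n b) * volume.real (B ∩ Ico 0 1) ≤
      K a ^ 2 * volume.real (Cyl a n b ∩ (lsv a)^[n] ⁻¹' B) := by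
  obtain ⟨d, hd, h⟩ := cyl_bounds ha n b hb
  have hK := one_le_K ha
  obtain ⟨h1, h2⟩ := h B hB
  obtain ⟨h3, h4⟩ := h univ MeasurableSet.univ
  simp only [univ_inter, preimage_univ, inter_univ, Real.volume_real_Ico, sub_zero] at h3 h4
  norm_num at h3 h4
  have nb : 0 ≤ volume.real (B ∩ Ico 0 1) := measureReal_nonneg
  have nc : 0 ≤ volume.real (Cyl a n b) := measureReal_nonneg
  constructor
  · refine le_of_mul_le_mul_left ?_ hd
    calc _ ≤ _ := h2
      _ = K a * volume.real (B ∩ Ico 0 1) * 1 := by ring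
      _ ≤ K a * volume.real (B ∩ Ico 0 1) * (K a * d * volume.real (Cyl a n b)) := by gcongr
      _ = _ := by ring
  · refine le_of_mul_le_mul_left ?_ hd
    calc _ = (d * volume.real (Cyl a n b)) * volume.real (B ∩ Ico 0 1) := by ring
      _ ≤ K a * (K a * d * volume.real (Cyl a n b ∩ (lsv a)^[n] ⁻¹' B)) := by gcongr
      _ = _ := by ring

/-! ### the good set -/

/-- points whose orbit never hits `0` -/
def G (a : ℝ) : Set ℝ := {x | x ∈ Ico (0 : ℝ) 1 ∧ ∀ k, (lsv a)^[k] x ≠ 0}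

lemma countable_zero (ha : 1 ≤ a) (k : ℕ) : {x | x ∈ Ico (0 : ℝ) 1 ∧ (lsv a)^[k] x = 0}.Countable := by
  induction k with
  | zero =>
    refine (countable_singleton (0 : ℝ)).mono ?_
    rintro x ⟨_, h⟩; simpa using h
  | succ k ih =>
    have hinj : ∀ c : Prop, InjOn (lsv a) {x | x ∈ Ico (0 : ℝ) 1 ∧ (x < 1 / 2 ↔ c)} := by
      intro c x hx y hy h
      have := cyl_injOn ha 1 (fun _ => c)
      refine this (x₁ := x) (x₂ := y) ?_ ?_ h
      · exact ⟨hx.1, by simpa using hx.2⟩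
      · exact ⟨hy.1, by simpa using hy.2⟩
    have hc : ∀ c : Prop, {x | x ∈ Ico (0 : ℝ) 1 ∧ (x < 1 / 2 ↔ c) ∧ (lsv a)^[k + 1] x = 0}.Countable := by
      intro c
      refine MapsTo.countable_of_injOn (f := lsv a) ?_ ((hinj c).mono ?_) ih
      · intro x hx
        exact ⟨lsv_mem ha hx.1, hx.2.2⟩
      · intro x hx
        exact ⟨hx.1, hx.2.1⟩
    refine ((hc True).union (hc False)).mono ?_
    rintro x ⟨hx, h⟩
    by_cases hx2 : x < 1 / 2
    · left; exact ⟨hx, by simpa using hx2, h⟩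
    · right; exact ⟨hx, by simpa using hx2, h⟩

lemma G_eq : G a = Ico 0 1 \ ⋃ k, {x | x ∈ Ico (0 : ℝ) 1 ∧ (lsv a)^[k] x = 0} := by
  ext x
  simp only [G, mem_ofPred_eq, Set.mem_sdiff, mem_iUnion, not_exists, not_and]
  constructor
  · rintro ⟨h, h2⟩; exact ⟨h, fun k _ => h2 k⟩
  · rintro ⟨h, h2⟩; exact ⟨h, fun k => h2 k h⟩

lemma measurable_G (ha : 1 ≤ a) : MeasurableSet (G a) := by
  rw [G_eq]
  exact measurableSet_Ico.diff (countable_iUnion (countable_zero ha)).measurableSet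

lemma G_ae (ha : 1 ≤ a) : G a =ᵐ[volume] Ico (0 : ℝ) 1 := by
  rw [G_eq]
  exact sdiff_null_ae_eq_self ((countable_iUnion (countable_zero ha)).measure_zero _)

lemma G_pos {x : ℝ} (ha : 1 ≤ a) (hx : x ∈ G a) (k : ℕ) : 0 < (lsv a)^[k] x :=
  lt_of_le_of_ne (iter_mem ha hx.1 k).1 (hx.2 k).symm

lemma G_iter {x : ℝ} (ha : 1 ≤ a) (hx : x ∈ G a) (k : ℕ) : (lsv a)^[k] x ∈ G a :=
  ⟨iter_mem ha hx.1 k, fun j => by rw [← Function.iterate_add_apply]; exact hx.2 _⟩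

end LSV

namespace LSV
variable {a : ℝ}

/-! ### tail estimates -/

lemma s_upper (ha : 1 ≤ a) {x : ℝ} (h0 : 0 < x) (h : x < 1 / 2) :
    (lsv a x) ^ (-a) ≤ x ^ (-a) - 2 ^ a / 2 := by
  have hq := qlt ha h0.le h
  have hq0 : 0 < (2 : ℝ) ^ a * x ^ a := by positivity
  rw [lsv_left h, mul_rpow h0.le (by linarith)]
  have e : x ^ (-a) * (2 ^ a * x ^ a) = 2 ^ a := by
    rw [rpow_neg h0.le]; field_simp
  set z := (2 : ℝ) ^ a * x ^ a with hz
  have h1 : (1 + z) ^ (-a) ≤ (1 + z) ^ (-1 : ℝ) := by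
    apply rpow_le_rpow_of_exponent_le <;> linarith
  have h2 : (1 + z) ^ (-1 : ℝ) ≤ 1 - z / 2 := by
    rw [rpow_neg_one, inv_le_iff_one_le_mul₀ (by linarith)]
    nlinarith
  have hx : 0 < x ^ (-a) := by positivity
  calc x ^ (-a) * (1 + z) ^ (-a) ≤ x ^ (-a) * (1 - z / 2) := by gcongr; linarith
    _ = x ^ (-a) - (x ^ (-a) * z) / 2 := by ring
    _ = _ := by rw [e]

lemma s_lower (ha : 1 ≤ a) {x : ℝ} (h0 : 0 < x) (h : x < 1 / 2) :
    x ^ (-a) - a * 2 ^ a ≤ (lsv a x) ^ (-a) := by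
  have hq0 : 0 < (2 : ℝ) ^ a * x ^ a := by positivity
  rw [lsv_left h, mul_rpow h0.le (by linarith)]
  have e : x ^ (-a) * (2 ^ a * x ^ a) = 2 ^ a := by
    rw [rpow_neg h0.le]; field_simp
  set z := (2 : ℝ) ^ a * x ^ a with hz
  have h1 : 1 - a * z ≤ (1 + z) ^ (-a) := by
    calc 1 - a * z ≤ Real.exp (-(a * z)) := by have := Real.add_one_le_exp (-(a * z)); linarith
      _ = (Real.exp z) ^ (-a) := by rw [← Real.exp_mul]; ring_nf
      _ ≤ _ := by
        apply rpow_le_rpow_of_nonpos (by linarith) _ (by linarith)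
        have := Real.add_one_le_exp z; linarith
  have hx : 0 < x ^ (-a) := by positivity
  calc _ = x ^ (-a) - a * (x ^ (-a) * z) := by rw [e]
    _ = x ^ (-a) * (1 - a * z) := by ring
    _ ≤ _ := by gcongr

lemma tail_upper (ha : 1 ≤ a) {x : ℝ} (hx : x ∈ G a) (m : ℕ) (h : ∀ i < m, (lsv a)^[i] x < 1 / 2) :
    (m : ℝ) ≤ x ^ (-a) := by
  have key : ∀ m : ℕ, (∀ i < m, (lsv a)^[i] x < 1 / 2) →
      ((lsv a)^[m] x) ^ (-a) ≤ x ^ (-a) - m * (2 ^ a / 2) := by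
    intro m
    induction m with
    | zero => intro _; simp
    | succ m ih =>
      intro h
      have h1 := ih fun i hi => h i (by omega)
      have h2 := s_upper ha (G_pos ha hx m) (h m (by omega))
      rw [Function.iterate_succ_apply']
      push_cast
      linarith
  have h1 := key m h
  have h2 : 0 < ((lsv a)^[m] x) ^ (-a) := rpow_pos_of_pos (G_pos ha hx m) _
  have h3 : (2 : ℝ) ≤ 2 ^ a := by
    calc (2 : ℝ) = 2 ^ (1 : ℝ) := by simp
      _ ≤ _ := rpow_le_rpow_of_exponent_le (by norm_num) ha
  have h4 : (0 : ℝ) ≤ m := by positivity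
  nlinarith

lemma half_of_s (ha : 1 ≤ a) {x : ℝ} (_h0 : 0 < x) (h : 2 ^ a < x ^ (-a)) : x < 1 / 2 := by
  by_contra hx
  push Not at hx
  have : x ^ (-a) ≤ (1 / 2) ^ (-a) := rpow_le_rpow_of_nonpos (by norm_num) hx (by linarith)
  rw [one_div, inv_rpow (by norm_num), rpow_neg (x := 2) (by norm_num), inv_inv] at this
  linarith

lemma tail_lower (ha : 1 ≤ a) {x : ℝ} (hx : x ∈ G a) (m : ℕ)
    (h : 2 ^ a * (1 + a * m) < x ^ (-a)) : ∀ i < m, (lsv a)^[i] x < 1 / 2 := by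
  have h2 : (0 : ℝ) < 2 ^ a := by positivity
  have key : ∀ i : ℕ, i ≤ m → x ^ (-a) - i * (a * 2 ^ a) ≤ ((lsv a)^[i] x) ^ (-a) := by
    intro i
    induction i with
    | zero => intro _; simp
    | succ i ih =>
      intro hi
      have h1 := ih (by omega)
      have h3 : ((i : ℝ) + 1) ≤ m := by exact_mod_cast hi
      have h5 : (i : ℝ) * (a * 2 ^ a) ≤ m * (a * 2 ^ a) := by gcongr; linarith
      have h4 := s_lower ha (G_pos ha hx i) (half_of_s ha (G_pos ha hx i) (by nlinarith))
      rw [Function.iterate_succ_apply']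
      push_cast
      linarith
  intro i hi
  have h1 := key i hi.le
  have h3 : (i : ℝ) ≤ m := by exact_mod_cast hi.le
  have h5 : (i : ℝ) * (a * 2 ^ a) ≤ m * (a * 2 ^ a) := by gcongr
  exact half_of_s ha (G_pos ha hx i) (by nlinarith)

/-! ### the jump transformation -/

/-- number of leading zeros -/
def tau (a : ℝ) (x : ℝ) : ℕ := sInf {k | 1 / 2 ≤ (lsv a)^[k] x}

/-- jump transformation -/
def F (a : ℝ) (x : ℝ) : ℝ := (lsv a)^[tau a x + 1] x

/-- time after `n` jumps -/
def S (a : ℝ) (n : ℕ) (x : ℝ) : ℕ := ∑ i ∈ Finset.range n, (tau a ((F a)^[i] x) + 1)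

lemma tau_nonempty (ha : 1 ≤ a) {x : ℝ} (hx : x ∈ G a) : ∃ k, 1 / 2 ≤ (lsv a)^[k] x := by
  by_contra h
  push Not at h
  obtain ⟨m, hm⟩ := exists_nat_gt (x ^ (-a))
  have := tail_upper ha hx m fun i _ => h i
  linarith

lemma tau_ge (ha : 1 ≤ a) {x : ℝ} (hx : x ∈ G a) : 1 / 2 ≤ (lsv a)^[tau a x] x :=
  Nat.sInf_mem (s := {k | 1 / 2 ≤ (lsv a)^[k] x}) (tau_nonempty ha hx)

lemma tau_lt {x : ℝ} {i : ℕ} (hi : i < tau a x) : (lsv a)^[i] x < 1 / 2 := by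
  have := Nat.notMem_of_lt_sInf hi
  simpa using this

lemma le_tau (ha : 1 ≤ a) {x : ℝ} (hx : x ∈ G a) {m : ℕ} (h : ∀ i < m, (lsv a)^[i] x < 1 / 2) :
    m ≤ tau a x := by
  by_contra hc
  push Not at hc
  exact absurd (tau_ge ha hx) (not_le.2 (h _ hc))

lemma tau_eq_of {x : ℝ} {m : ℕ} (h : ∀ i < m, (lsv a)^[i] x < 1 / 2)
    (h2 : 1 / 2 ≤ (lsv a)^[m] x) : tau a x = m := by
  apply le_antisymm
  · exact Nat.sInf_le h2
  · by_contra hc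
    push Not at hc
    have hm : tau a x ∈ {k | 1 / 2 ≤ (lsv a)^[k] x} := Nat.sInf_mem ⟨m, h2⟩
    exact absurd (h _ hc) (not_lt.2 hm)

lemma tau_bound (ha : 1 ≤ a) {x : ℝ} (hx : x ∈ G a) : ((tau a x + 1 : ℕ) : ℝ) ≤ 2 * x ^ (-a) := by
  have h1 := tail_upper ha hx (tau a x) fun i hi => tau_lt hi
  have h2 : 1 ≤ x ^ (-a) :=
    one_le_rpow_of_pos_of_le_one_of_nonpos (G_pos ha hx 0) hx.1.2.le (by linarith)
  push_cast; linarith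

lemma F_mem (ha : 1 ≤ a) {x : ℝ} (hx : x ∈ G a) : F a x ∈ G a := G_iter ha hx _

lemma F_iter_mem (ha : 1 ≤ a) {x : ℝ} (hx : x ∈ G a) (n : ℕ) : (F a)^[n] x ∈ G a := by
  induction n with
  | zero => simpa
  | succ n ih => rw [Function.iterate_succ_apply']; exact F_mem ha ih

lemma S_succ (n : ℕ) (x : ℝ) : S a (n + 1) x = S a n x + (tau a ((F a)^[n] x) + 1) :=
  Finset.sum_range_succ _ _

lemma S_succ' (n : ℕ) (x : ℝ) : S a (n + 1) x = S a n (F a x) + (tau a x + 1) :=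
  Finset.sum_range_succ' _ _

lemma S_add (n k : ℕ) (x : ℝ) : S a n x + k ≤ S a (n + k) x := by
  induction k with
  | zero => simp
  | succ k ih => rw [← add_assoc n, S_succ]; omega

lemma S_mono (x : ℝ) : Monotone fun n => S a n x :=
  monotone_nat_of_le_succ fun n => by rw [S_succ]; omega

lemma le_S (n : ℕ) (x : ℝ) : n ≤ S a n x := by
  have := S_add (a := a) 0 n x
  simp at this; omega

lemma F_iter (n : ℕ) (x : ℝ) : (F a)^[n] x = (lsv a)^[S a n x] x := by
  induction n with
  | zero => simp [S]
  | succ n ih =>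
    rw [Function.iterate_succ_apply', S_succ, add_comm, Function.iterate_add_apply, ← ih, F]

lemma last_one (ha : 1 ≤ a) {x : ℝ} (hx : x ∈ G a) (n m : ℕ) (h : S a n x = m + 1) :
    1 / 2 ≤ (lsv a)^[m] x := by
  cases n with
  | zero => simp [S] at h
  | succ n =>
    rw [S_succ] at h
    have : m = tau a ((F a)^[n] x) + S a n x := by omega
    rw [this, Function.iterate_add_apply, ← F_iter]
    exact tau_ge ha (F_iter_mem ha hx n)

/-- every time following a one is a jump time -/
lemma exists_S {x : ℝ} (m : ℕ) (h : 1 / 2 ≤ (lsv a)^[m] x) :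
    ∃ n, S a n x = m + 1 := by
  have hex : ∃ n, m < S a n x := ⟨m + 1, le_S (m + 1) x⟩
  classical
  obtain ⟨n, hn, hmin⟩ : ∃ n, m < S a n x ∧ ∀ j < n, ¬ m < S a j x :=
    ⟨Nat.find hex, Nat.find_spec hex, fun j hj => Nat.find_min hex hj⟩
  refine ⟨n, ?_⟩
  cases n with
  | zero => simp [S] at hn
  | succ n =>
    have h1 := hmin n (by omega)
    rw [S_succ] at hn ⊢
    by_contra hne
    have h2 : m - S a n x < tau a ((F a)^[n] x) := by omega
    have h3 := tau_lt h2
    rw [F_iter, ← Function.iterate_add_apply, Nat.sub_add_cancel (by omega)] at h3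
    linarith

lemma tau_iff (ha : 1 ≤ a) {x y : ℝ} (hx : x ∈ G a) (hy : y ∈ G a) : tau a y = tau a x ↔
      ∀ j < tau a x + 1, ((lsv a)^[j] y < 1 / 2 ↔ (lsv a)^[j] x < 1 / 2) := by
  constructor
  · intro h j hj
    rcases Nat.lt_succ_iff_lt_or_eq.1 hj with h' | h'
    · exact ⟨fun _ => tau_lt h', fun _ => tau_lt (by omega)⟩
    · have h1 := tau_ge ha hx
      have h2 := tau_ge ha hy
      rw [h] at h2
      subst h'
      exact ⟨fun h => absurd h (not_lt.2 h2), fun h => absurd h (not_lt.2 h1)⟩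
  · intro h
    apply tau_eq_of
    · intro i hi; exact (h i (by omega)).2 (tau_lt hi)
    · have := h (tau a x) (by omega)
      have h1 := tau_ge ha hx
      by_contra hc
      push Not at hc
      linarith [this.1 hc]

lemma digits_iff (ha : 1 ≤ a) (n : ℕ) {x y : ℝ} (hx : x ∈ G a) (hy : y ∈ G a) :
    (∀ i < n, tau a ((F a)^[i] y) = tau a ((F a)^[i] x)) ↔
      ∀ j < S a n x, ((lsv a)^[j] y < 1 / 2 ↔ (lsv a)^[j] x < 1 / 2) := by
  induction n generalizing x y with
  | zero => simp [S]
  | succ n ih =>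
    have e1 : (∀ i < n + 1, tau a ((F a)^[i] y) = tau a ((F a)^[i] x)) ↔
        (tau a y = tau a x ∧ ∀ i < n, tau a ((F a)^[i] (F a y)) = tau a ((F a)^[i] (F a x))) := by
      constructor
      · intro h
        exact ⟨h 0 (by omega), fun i hi => h (i + 1) (by omega)⟩
      · rintro ⟨h, h2⟩ i hi
        cases i with
        | zero => exact h
        | succ i => exact h2 i (by omega)
    have htau := tau_iff ha hx hy
    have ih' := ih (F_mem ha hx) (F_mem ha hy)
    rw [e1, S_succ', ih']
    constructor
    · rintro ⟨h1, h2⟩ j hj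
      by_cases hj2 : j < tau a x + 1
      · exact htau.1 h1 j hj2
      · have h3 := h2 (j - (tau a x + 1)) (by omega)
        rw [F, F, h1, ← Function.iterate_add_apply, ← Function.iterate_add_apply,
            Nat.sub_add_cancel (by omega)] at h3
        exact h3
    · intro h
      have h1 := htau.2 fun j hj => h j (by omega)
      refine ⟨h1, fun j hj => ?_⟩
      rw [F, F, h1, ← Function.iterate_add_apply, ← Function.iterate_add_apply]
      exact h _ (by omega)

end LSV

namespace LSV
variable {a : ℝ}

/-- the reference measure -/
def mu : Measure ℝ := volume.restrict (Ico (0 : ℝ) 1)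

instance : IsProbabilityMeasure mu := ⟨by simp [mu]⟩

lemma ae_G (ha : 1 ≤ a) : ∀ᵐ x ∂mu, x ∈ G a := by
  rw [mu, ← Measure.restrict_congr_set (G_ae ha)]
  exact ae_restrict_mem (measurable_G ha)

lemma mu_congr (ha : 1 ≤ a) {A B : Set ℝ} (h : ∀ x ∈ G a, x ∈ A ↔ x ∈ B) : mu A = mu B := by
  apply measure_congr
  filter_upwards [ae_G ha] with x hx
  exact propext (h x hx)

lemma mu_apply (A : Set ℝ) : mu A = volume (A ∩ Ico 0 1) := by
  rw [mu, Measure.restrict_apply' measurableSet_Ico]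

lemma measurable_tau : Measurable (tau a) := by
  refine measurable_to_countable' fun k => ?_
  have : tau a ⁻¹' {k} = ({x | 1 / 2 ≤ (lsv a)^[k] x} ∩ ⋂ i : Fin k, {x | (lsv a)^[i] x < 1 / 2}) ∪
      ({x | k = 0} ∩ ⋂ i : ℕ, {x | (lsv a)^[i] x < 1 / 2}) := by
    ext x
    simp only [mem_preimage, mem_singleton_iff, mem_union, mem_inter_iff, mem_ofPred_eq, mem_iInter]
    constructor
    · intro h
      by_cases hx : ∃ k, 1 / 2 ≤ (lsv a)^[k] x
      · left
        have hm : tau a x ∈ {k | 1 / 2 ≤ (lsv a)^[k] x} := Nat.sInf_mem hx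
        rw [h] at hm
        exact ⟨hm, fun i => tau_lt (by rw [h]; exact i.2)⟩
      · push Not at hx
        right
        refine ⟨?_, hx⟩
        rw [← h, tau]
        have : {k | 1 / 2 ≤ (lsv a)^[k] x} = ∅ := by
          ext j; simpa using hx j
        rw [this]; simp
    · rintro (⟨h1, h2⟩ | ⟨h1, h2⟩)
      · exact tau_eq_of (fun i hi => h2 ⟨i, hi⟩) h1
      · have : {k | 1 / 2 ≤ (lsv a)^[k] x} = ∅ := by
          ext j; simpa using h2 j
        rw [h1, tau, this]; simp
  rw [this]
  refine MeasurableSet.union (MeasurableSet.inter ?_ ?_) (MeasurableSet.inter (.const _) ?_)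
  · exact measurableSet_le measurable_const (measurable_iter k)
  · exact MeasurableSet.iInter fun i => measurableSet_lt (measurable_iter _) measurable_const
  · exact MeasurableSet.iInter fun i => measurableSet_lt (measurable_iter _) measurable_const

lemma measurable_F : Measurable (F a) := by
  have h : Measurable (fun p : ℕ × ℝ => (lsv a)^[p.1] p.2) :=
    measurable_from_prod_countable_right fun n => measurable_iter n
  exact h.comp ((measurable_tau.add_const 1).prodMk measurable_id)

lemma measurable_F_iter (n : ℕ) : Measurable ((F a)^[n]) := measurable_F.iterate n

/-- digits of the jump transformation -/
def dig (a : ℝ) (n : ℕ) (x : ℝ) : Fin n → ℕ := fun i => tau a ((F a)^[i] x)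

lemma measurable_dig (n : ℕ) : Measurable (dig a n) :=
  measurable_pi_lambda _ fun i => measurable_tau.comp (measurable_F_iter i)

/-- `E` depends only on the first `n` digits -/
def Det (a : ℝ) (n : ℕ) (E : Set ℝ) : Prop :=
  ∀ x ∈ G a, ∀ y ∈ G a, (∀ i < n, tau a ((F a)^[i] y) = tau a ((F a)^[i] x)) → (y ∈ E ↔ x ∈ E)

lemma tsum_dig (n : ℕ) (A : Set ℝ) : mu A = ∑' w : Fin n → ℕ, mu (dig a n ⁻¹' {w} ∩ A) := by
  have h1 : ∀ w : Fin n → ℕ, mu (dig a n ⁻¹' {w} ∩ A) = (mu.restrict A) (dig a n ⁻¹' {w}) := by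
    intro w
    rw [Measure.restrict_apply (measurable_dig n (measurableSet_singleton w))]
  simp_rw [h1]
  have := tsum_measure_preimage_singleton (μ := mu.restrict A) (f := dig a n)
    (countable_univ (α := Fin n → ℕ)) fun y _ => measurable_dig n (measurableSet_singleton y)
  rw [preimage_univ, Measure.restrict_apply_univ] at this
  rw [← this]
  exact tsum_univ fun w => (mu.restrict A) (dig a n ⁻¹' {w})

def C (a : ℝ) : ENNReal := ENNReal.ofReal (K a ^ 2)

lemma word_qi (ha : 1 ≤ a) (n : ℕ) {E : Set ℝ} (hE : Det a n E) {B : Set ℝ} (hB : MeasurableSet B)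
    (w : Fin n → ℕ) :
    mu (dig a n ⁻¹' {w} ∩ (E ∩ (F a)^[n] ⁻¹' B)) ≤ C a * (mu (dig a n ⁻¹' {w} ∩ E) * mu B) ∧
    mu (dig a n ⁻¹' {w} ∩ E) * mu B ≤ C a * mu (dig a n ⁻¹' {w} ∩ (E ∩ (F a)^[n] ⁻¹' B)) := by
  by_cases hne : ∃ x, x ∈ G a ∧ x ∈ dig a n ⁻¹' {w} ∩ E
  · obtain ⟨x, hxG, hxw, hxE⟩ := hne
    set N := S a n x with hN
    set b : ℕ → Prop := fun j => (lsv a)^[j] x < 1 / 2 with hb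
    have hdw : ∀ y ∈ G a, (y ∈ dig a n ⁻¹' {w} ∩ E ↔ y ∈ Cyl a N b) := by
      intro y hy
      have h1 := digits_iff ha n hxG hy
      have h2 : y ∈ Cyl a N b ↔ ∀ i < n, tau a ((F a)^[i] y) = tau a ((F a)^[i] x) := by
        rw [h1]; exact ⟨fun h => h.2, fun h => ⟨hy.1, h⟩⟩
      have h3 : y ∈ dig a n ⁻¹' {w} ↔ ∀ i < n, tau a ((F a)^[i] y) = tau a ((F a)^[i] x) := by
        have : dig a n x = w := hxw
        rw [mem_preimage, mem_singleton_iff, ← this]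
        constructor
        · intro h i hi; exact congrFun h ⟨i, hi⟩
        · intro h; ext i; exact h i i.2
      rw [h2, ← h3]
      exact ⟨fun h => h.1, fun h => ⟨h, (hE x hxG y hy (h3.1 h)).2 hxE⟩⟩
    have hSN : ∀ y ∈ G a, y ∈ Cyl a N b → (F a)^[n] y = (lsv a)^[N] y := by
      intro y hy hyC
      have h1 := (digits_iff ha n hxG hy).2 hyC.2
      have h4 : S a n y = N :=
        Finset.sum_congr rfl fun i hi => by rw [h1 i (Finset.mem_range.1 hi)]
      rw [F_iter, h4]
    have e1 : mu (dig a n ⁻¹' {w} ∩ E) = volume (Cyl a N b) := by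
      rw [mu_congr ha hdw, mu_apply, inter_eq_left.2]
      exact fun x hx => hx.1
    have e2 : mu (dig a n ⁻¹' {w} ∩ (E ∩ (F a)^[n] ⁻¹' B)) =
        volume (Cyl a N b ∩ (lsv a)^[N] ⁻¹' B) := by
      rw [← inter_assoc, mu_congr ha (B := Cyl a N b ∩ (lsv a)^[N] ⁻¹' B), mu_apply, inter_eq_left.2]
      · exact fun x hx => hx.1.1
      · intro y hy
        refine (and_congr_left' (hdw y hy)).trans ?_
        constructor
        · rintro ⟨h, h2⟩; exact ⟨h, by rwa [mem_preimage, ← hSN y hy h]⟩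
        · rintro ⟨h, h2⟩; exact ⟨h, by rwa [mem_preimage, hSN y hy h]⟩
    have q := cyl_qi ha N b (fun m hm => not_lt.2 (last_one ha hxG n m hm)) hB
    have f1 : mu (dig a n ⁻¹' {w} ∩ E) ≠ ⊤ := measure_ne_top _ _
    have f2 : mu (dig a n ⁻¹' {w} ∩ (E ∩ (F a)^[n] ⁻¹' B)) ≠ ⊤ := measure_ne_top _ _
    have fC : C a ≠ ⊤ := ENNReal.ofReal_ne_top
    have f3 : mu B ≠ ⊤ := measure_ne_top _ _
    simp only [Measure.real] at q
    rw [← e1, ← e2, ← mu_apply] at q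
    rw [← ENNReal.toReal_le_toReal f2 (ENNReal.mul_ne_top fC
      (ENNReal.mul_ne_top f1 f3)), ← ENNReal.toReal_le_toReal (ENNReal.mul_ne_top f1 f3)
        (ENNReal.mul_ne_top fC f2)]
    simp only [ENNReal.toReal_mul, C, ENNReal.toReal_ofReal (sq_nonneg (K a))]
    exact q
  · have e1 : mu (dig a n ⁻¹' {w} ∩ E) = 0 := by
      rw [mu_congr ha (B := ∅), measure_empty]
      intro x hx
      simp only [mem_empty_iff_false, iff_false]
      exact fun h => hne ⟨x, hx, h⟩
    have e2 : mu (dig a n ⁻¹' {w} ∩ (E ∩ (F a)^[n] ⁻¹' B)) = 0 :=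
      measure_mono_null (by rw [← inter_assoc]; exact inter_subset_left) e1
    rw [e1, e2]; simp

lemma qi_upper (ha : 1 ≤ a) (n : ℕ) {E : Set ℝ} (hE : Det a n E) {B : Set ℝ} (hB : MeasurableSet B) :
    mu (E ∩ (F a)^[n] ⁻¹' B) ≤ C a * (mu E * mu B) := by
  rw [tsum_dig (a := a) n (E ∩ (F a)^[n] ⁻¹' B), tsum_dig (a := a) n E, ← ENNReal.tsum_mul_right,
    ← ENNReal.tsum_mul_left]
  exact ENNReal.tsum_le_tsum fun w => (word_qi ha n hE hB w).1

lemma qi_lower (ha : 1 ≤ a) (n : ℕ) {E : Set ℝ} (hE : Det a n E) {B : Set ℝ} (hB : MeasurableSet B) :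
    mu E * mu B ≤ C a * mu (E ∩ (F a)^[n] ⁻¹' B) := by
  rw [tsum_dig (a := a) n (E ∩ (F a)^[n] ⁻¹' B), tsum_dig (a := a) n E, ← ENNReal.tsum_mul_right,
    ← ENNReal.tsum_mul_left]
  exact ENNReal.tsum_le_tsum fun w => (word_qi ha n hE hB w).2

lemma pre_upper (ha : 1 ≤ a) (n : ℕ) {B : Set ℝ} (hB : MeasurableSet B) :
    mu ((F a)^[n] ⁻¹' B) ≤ C a * mu B := by
  have := qi_upper ha n (E := univ) (fun _ _ _ _ _ => by simp) hB
  simpa using this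

lemma map_le (ha : 1 ≤ a) (n : ℕ) : Measure.map ((F a)^[n]) mu ≤ C a • mu := by
  refine Measure.le_iff.2 fun s hs => ?_
  rw [Measure.map_apply (measurable_F_iter n) hs]
  simpa using pre_upper ha n hs

/-- no block of length `l` among the first `M` ones lies in `B` -/
def Avoid (a : ℝ) (l : ℕ) (B : Set ℝ) (M : ℕ) : Set ℝ := {x | ∀ j < M, (F a)^[j * l] x ∉ B}

lemma det_avoid (ha : 1 ≤ a) {l : ℕ} {B : Set ℝ} (hd : Det a l B) (M : ℕ) :
    Det a (M * l) (Avoid a l B M) := by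
  intro x hx y hy h
  refine forall₂_congr fun j hj => ?_
  refine not_congr (hd _ (F_iter_mem ha hx _) _ (F_iter_mem ha hy _) ?_)
  intro i hi
  rw [← Function.iterate_add_apply, ← Function.iterate_add_apply]
  apply h
  calc i + j * l < l + j * l := by omega
    _ = (j + 1) * l := by ring
    _ ≤ M * l := Nat.mul_le_mul_right l hj

lemma avoid_bound (ha : 1 ≤ a) {l : ℕ} {B : Set ℝ} (hB : MeasurableSet B) (hd : Det a l B) (M : ℕ) :
    mu.real (Avoid a l B M) ≤ Real.exp (-(mu.real B / K a ^ 2 * M)) := by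
  induction M with
  | zero => simp
  | succ M ih =>
    have hK := one_le_K ha
    have e : Avoid a l B (M + 1) = Avoid a l B M \ ((F a)^[M * l] ⁻¹' B) := by
      ext x; simp only [Avoid, mem_ofPred_eq, Set.mem_sdiff, Nat.forall_lt_succ_right, mem_preimage]
    have h1 := measureReal_inter_add_sdiff (μ := mu) (s := Avoid a l B M) (measurable_F_iter (a := a) (M * l) hB)
    rw [← e] at h1
    have h2 := qi_lower ha (M * l) (det_avoid ha hd M) hB
    have h3 : mu.real (Avoid a l B M) * mu.real B ≤
        K a ^ 2 * mu.real (Avoid a l B M ∩ (F a)^[M * l] ⁻¹' B) := by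
      have := ENNReal.toReal_mono (ENNReal.mul_ne_top ENNReal.ofReal_ne_top (measure_ne_top _ _)) h2
      simpa only [Measure.real, ENNReal.toReal_mul, C, ENNReal.toReal_ofReal (sq_nonneg (K a))] using this
    have h4 : mu.real (Avoid a l B M) * (mu.real B / K a ^ 2) ≤
        mu.real (Avoid a l B M ∩ (F a)^[M * l] ⁻¹' B) := by
      rw [← mul_div_assoc, div_le_iff₀ (by positivity)]; linarith
    set β := mu.real B / K a ^ 2
    have h5 : 1 - β ≤ Real.exp (-β) := by have := Real.add_one_le_exp (-β); linarith
    have h6 : 0 ≤ mu.real (Avoid a l B M) := measureReal_nonneg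
    calc mu.real (Avoid a l B (M + 1)) ≤ mu.real (Avoid a l B M) * (1 - β) := by linarith
      _ ≤ mu.real (Avoid a l B M) * Real.exp (-β) := by gcongr
      _ ≤ Real.exp (-(β * M)) * Real.exp (-β) := by gcongr
      _ = _ := by rw [← Real.exp_add]; push_cast; ring_nf

/-- Borel–Cantelli for avoidance events. -/
lemma avoid_bc (ha : 1 ≤ a) {l : ℕ → ℕ} {B : ℕ → Set ℝ} {M : ℕ → ℕ} {c : ℝ} (hc : 0 < c)
    (hB : ∀ k, MeasurableSet (B k)) (hd : ∀ k, Det a (l k) (B k))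
    (hM : ∀ k : ℕ, c * k ≤ mu.real (B k) * M k) :
    ∀ᵐ x ∂mu, ∀ᶠ k in atTop, ∃ j < M k, (F a)^[j * l k] x ∈ B k := by
  have hK := one_le_K ha
  have hs : Summable fun k : ℕ => Real.exp (-(c / K a ^ 2)) ^ k := by
    apply summable_geometric_of_lt_one (by positivity)
    rw [Real.exp_lt_one_iff]
    have : 0 < c / K a ^ 2 := by positivity
    linarith
  have h1 : ∀ k, mu.real (Avoid a (l k) (B k) (M k)) ≤ Real.exp (-(c / K a ^ 2)) ^ k := by
    intro k
    refine (avoid_bound ha (hB k) (hd k) (M k)).trans ?_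
    rw [← Real.exp_nat_mul]
    apply Real.exp_le_exp.2
    have := div_le_div_of_nonneg_right (hM k) (sq_nonneg (K a))
    have e1 : mu.real (B k) * M k / K a ^ 2 = mu.real (B k) / K a ^ 2 * M k := by ring
    have e2 : c * k / K a ^ 2 = k * (c / K a ^ 2) := by ring
    rw [e1, e2] at this
    linarith
  have h2 : ∑' k, mu (Avoid a (l k) (B k) (M k)) ≠ ⊤ := by
    have : ∀ k, mu (Avoid a (l k) (B k) (M k)) ≤ ENNReal.ofReal (Real.exp (-(c / K a ^ 2)) ^ k) := by
      intro k
      rw [← ofReal_measureReal]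
      exact ENNReal.ofReal_le_ofReal (h1 k)
    exact ne_top_of_le_ne_top hs.tsum_ofReal_ne_top (ENNReal.tsum_le_tsum this)
  filter_upwards [ae_eventually_notMem h2] with x hx
  filter_upwards [hx] with k hk
  simpa [Avoid] using hk

end LSV

namespace LSV
variable {a : ℝ}

/-- points starting with `k` ones -/
def Z (a : ℝ) (k : ℕ) : Set ℝ := {x | ∀ m < k, 1 / 2 ≤ (lsv a)^[m] x}

lemma Z_anti {k l : ℕ} (h : k ≤ l) {x : ℝ} (hx : x ∈ Z a l) : x ∈ Z a k :=
  fun m hm => hx m (by omega)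

lemma Z_shift {k j : ℕ} {x : ℝ} (hx : x ∈ Z a (j + k)) : (lsv a)^[j] x ∈ Z a k := by
  intro m hm
  rw [← Function.iterate_add_apply]
  exact hx _ (by omega)

lemma Z_iff (k : ℕ) {x : ℝ} (hx : x ∈ Ico (0 : ℝ) 1) : x ∈ Z a k ↔ 1 - (1 / 2) ^ k ≤ x := by
  induction k generalizing x with
  | zero => simp [Z, hx.1]
  | succ k ih =>
    have h1 : x ∈ Z a (k + 1) ↔ 1 / 2 ≤ x ∧ lsv a x ∈ Z a k := by
      constructor
      · intro h; exact ⟨h 0 (by omega), fun m hm => h (m + 1) (by omega)⟩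
      · rintro ⟨h, h2⟩ m hm
        cases m with
        | zero => exact h
        | succ m => exact h2 m (by omega)
    have hp : (1 / 2 : ℝ) ^ k ≤ 1 := pow_le_one₀ (by norm_num) (by norm_num)
    have hp' : (1 / 2 : ℝ) ^ (k + 1) = (1 / 2) ^ k / 2 := by rw [pow_succ]; ring
    rw [h1, hp']
    constructor
    · rintro ⟨h, h2⟩
      rw [lsv_right (by linarith), ih ⟨by linarith, by linarith [hx.2]⟩] at h2
      linarith
    · intro h
      have h' : 1 / 2 ≤ x := by linarith
      refine ⟨h', ?_⟩
      rw [lsv_right (by linarith), ih ⟨by linarith, by linarith [hx.2]⟩]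
      linarith

lemma measurable_Z (k : ℕ) : MeasurableSet (Z a k) := by
  have : Z a k = ⋂ i : Fin k, {x | 1 / 2 ≤ (lsv a)^[i] x} := by
    ext x; simp only [Z, mem_ofPred_eq, mem_iInter]
    exact ⟨fun h i => h i i.2, fun h m hm => h ⟨m, hm⟩⟩
  rw [this]
  exact MeasurableSet.iInter fun i => measurableSet_le measurable_const (measurable_iter _)

lemma mu_Z (k : ℕ) : mu (Z a k) = ENNReal.ofReal ((1 / 2) ^ k) := by
  have hp : (1 / 2 : ℝ) ^ k ≤ 1 := pow_le_one₀ (by norm_num) (by norm_num)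
  have : Z a k ∩ Ico 0 1 = Ico (1 - (1 / 2) ^ k) 1 := by
    ext x
    constructor
    · rintro ⟨h, h2⟩; exact ⟨(Z_iff k h2).1 h, h2.2⟩
    · rintro ⟨h, h2⟩
      have : x ∈ Ico (0 : ℝ) 1 := ⟨by linarith, h2⟩
      exact ⟨(Z_iff k this).2 h, this⟩
  rw [mu_apply, this, Real.volume_Ico]; congr 1; ring

lemma det_Z (ha : 1 ≤ a) (k : ℕ) : Det a k (Z a k) := by
  intro x hx y hy h
  have h1 := (digits_iff ha k hx hy).1 h
  have h2 := le_S (a := a) k x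
  refine forall₂_congr fun m hm => ?_
  rw [← not_lt, ← not_lt, h1 m (by omega)]

lemma ae_ones (ha : 1 ≤ a) : ∀ᵐ x ∂mu, ∀ᶠ k : ℕ in atTop,
    ∃ i, i + k ≤ k * 2 ^ k * k ∧ (F a)^[i] x ∈ Z a k := by
  have := avoid_bc ha (l := fun k => k) (B := fun k => Z a k) (M := fun k => k * 2 ^ k) (c := 1)
    one_pos measurable_Z (det_Z ha) ?_
  · filter_upwards [this] with x hx
    filter_upwards [hx] with k hk
    obtain ⟨j, hj, h⟩ := hk
    refine ⟨j * k, ?_, h⟩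
    calc j * k + k = (j + 1) * k := by ring
      _ ≤ _ := Nat.mul_le_mul_right k hj
  · intro k
    rw [Measure.real, mu_Z, ENNReal.toReal_ofReal (by positivity)]
    push_cast
    rw [one_div, inv_pow]
    apply le_of_eq
    field_simp

lemma mu_T (ha : 1 ≤ a) (k : ℕ) :
    1 / (6 * a) * (1 / 2) ^ k ≤ mu.real {x | ⌈(2 : ℝ) ^ (a * k)⌉₊ ≤ tau a x} := by
  set m := ⌈(2 : ℝ) ^ (a * k)⌉₊ with hm
  set r : ℝ := 1 / (6 * a) * (1 / 2) ^ k with hr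
  have hr0 : 0 < r := by positivity
  have hr1 : r ≤ 1 := by
    have hp : (1 / 2 : ℝ) ^ k ≤ 1 := pow_le_one₀ (by norm_num) (by norm_num)
    have h6 : 1 / (6 * a) ≤ 1 := by rw [div_le_one (by linarith)]; linarith
    calc r ≤ 1 * 1 := by rw [hr]; gcongr
      _ = 1 := by ring
  have e : r = mu.real (Iio r) := by
    rw [Measure.real, mu_apply]
    have : Iio r ∩ Ico 0 1 = Ico 0 r := by
      ext x; simp only [mem_inter_iff, mem_Iio, mem_Ico]
      constructor
      · rintro ⟨h1, h2, h3⟩; exact ⟨h2, h1⟩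
      · rintro ⟨h1, h2⟩; exact ⟨h2, h1, by linarith⟩
    rw [this, Real.volume_Ico, sub_zero, ENNReal.toReal_ofReal hr0.le]
  rw [e]
  have : mu (Iio r) ≤ mu {x | m ≤ tau a x} := by
    apply measure_mono_ae
    filter_upwards [ae_G ha] with x hx hxr
    refine le_tau ha hx (tail_lower ha hx m ?_)
    have hx0 := G_pos ha hx 0
    simp only [Function.iterate_zero, id] at hx0
    have hxr' : x < r := hxr
    have h1 : r ^ (-a) < x ^ (-a) := rpow_lt_rpow_of_neg hx0 hxr' (by linarith)
    have hP : 1 ≤ (2 : ℝ) ^ (a * k) := one_le_rpow (by norm_num) (by positivity)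
    have h2 : r ^ (-a) = 2 ^ a * (3 * a) ^ a * 2 ^ (a * k) := by
      have e1 : r = ((6 * a) * 2 ^ (k : ℝ))⁻¹ := by
        rw [hr, rpow_natCast, one_div, one_div, inv_pow, ← mul_inv]
      rw [e1, inv_rpow (by positivity), rpow_neg (by positivity), inv_inv,
        mul_rpow (by positivity) (by positivity), ← rpow_mul (by norm_num), mul_comm (k : ℝ) a,
        ← mul_rpow (by norm_num) (by positivity)]
      ring_nf
    have h3 : (m : ℝ) ≤ 2 * 2 ^ (a * k) := by
      have := Nat.ceil_lt_add_one (a := (2 : ℝ) ^ (a * k)) (by positivity)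
      linarith
    have h4 : 3 * a ≤ (3 * a) ^ a := by
      calc 3 * a = (3 * a) ^ (1 : ℝ) := by simp
        _ ≤ _ := rpow_le_rpow_of_exponent_le (by linarith) ha
    have h5 : 1 + a * m ≤ (3 * a) * 2 ^ (a * k) := by nlinarith
    calc 2 ^ a * (1 + a * m) ≤ 2 ^ a * ((3 * a) ^ a * 2 ^ (a * k)) := by
          gcongr; exact h5.trans (by gcongr)
      _ = r ^ (-a) := by rw [h2]; ring
      _ < _ := h1
  exact ENNReal.toReal_mono (measure_ne_top _ _) this

lemma ae_zeros (ha : 1 ≤ a) : ∀ᵐ x ∂mu, ∀ᶠ k : ℕ in atTop,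
    ∃ i < k * 2 ^ k, (2 : ℝ) ^ (a * k) ≤ tau a ((F a)^[i] x) := by
  have := avoid_bc ha (l := fun _ => 1) (B := fun k => {x | ⌈(2 : ℝ) ^ (a * k)⌉₊ ≤ tau a x})
    (M := fun k => k * 2 ^ k) (c := 1 / (6 * a)) (by positivity) ?_ ?_ ?_
  · filter_upwards [this] with x hx
    filter_upwards [hx] with k hk
    obtain ⟨j, hj, h⟩ := hk
    refine ⟨j, hj, ?_⟩
    rw [mul_one] at h
    exact Nat.ceil_le.1 h
  · intro k; exact measurableSet_le measurable_const measurable_tau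
  · intro k x hx y hy h
    have := h 0 one_pos
    simp only [Function.iterate_zero, id] at this
    simp only [mem_ofPred_eq, this]
  · intro k
    have h1 := mu_T ha k
    have h2 : (1 / (6 * a)) * (k : ℝ) = (1 / (6 * a) * (1 / 2) ^ k) * ((k * 2 ^ k : ℕ) : ℝ) := by
      push_cast
      rw [one_div 2, inv_pow]; field_simp
    rw [h2]
    gcongr

lemma ae_runs (ha : 1 ≤ a) {ε : ℝ} (hε : 0 < ε) : ∀ᵐ x ∂mu, ∃ c : ℝ, ∀ i k : ℕ,
    (F a)^[i] x ∈ Z a k → (k : ℝ) ≤ c + (1 + ε) * logb 2 (i + 1) := by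
  set κ : ℕ → ℕ := fun i => ⌈(1 + ε) * logb 2 (i + 1)⌉₊ with hκ
  have hb : ∀ i : ℕ, mu ((F a)^[i] ⁻¹' Z a (κ i)) ≤
      C a * ENNReal.ofReal (1 / ((i : ℝ) + 1) ^ (1 + ε)) := by
    intro i
    refine (pre_upper ha i (measurable_Z _)).trans ?_
    rw [mu_Z]
    gcongr
    rw [one_div, inv_pow, ← one_div, ← rpow_natCast]
    apply one_div_le_one_div_of_le (by positivity)
    calc ((i : ℝ) + 1) ^ (1 + ε) = (2 ^ (logb 2 ((i : ℝ) + 1))) ^ (1 + ε) := by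
          rw [rpow_logb (by norm_num) (by norm_num) (by positivity)]
      _ = 2 ^ ((1 + ε) * logb 2 ((i : ℝ) + 1)) := by rw [← rpow_mul (by norm_num), mul_comm]
      _ ≤ _ := rpow_le_rpow_of_exponent_le (by norm_num) (Nat.le_ceil _)
  have hs : Summable fun i : ℕ => 1 / ((i : ℝ) + 1) ^ (1 + ε) := by
    have := (summable_nat_add_iff 1).2 (summable_one_div_nat_rpow.2 (by linarith : 1 < 1 + ε))
    simpa using this
  have hfin : ∑' i, mu ((F a)^[i] ⁻¹' Z a (κ i)) ≠ ⊤ := by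
    refine ne_top_of_le_ne_top ?_ (ENNReal.tsum_le_tsum hb)
    rw [ENNReal.tsum_mul_left]
    exact ENNReal.mul_ne_top ENNReal.ofReal_ne_top hs.tsum_ofReal_ne_top
  filter_upwards [ae_eventually_notMem hfin] with x hx
  obtain ⟨i0, hi0⟩ := eventually_atTop.1 hx
  refine ⟨κ i0 + i0 + 1, fun i k h => ?_⟩
  have hlog : ∀ i : ℕ, 0 ≤ (1 + ε) * logb 2 ((i : ℝ) + 1) := fun i =>
    mul_nonneg (by linarith) (logb_nonneg (by norm_num) (by linarith [Nat.cast_nonneg (α := ℝ) i]))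
  rcases le_or_gt i0 i with hi | hi
  · have h1 : k < κ i := by
      by_contra hc
      exact hi0 i hi (Z_anti (by omega) h)
    have h2 : (κ i : ℝ) < (1 + ε) * logb 2 (i + 1) + 1 := Nat.ceil_lt_add_one (hlog i)
    have h3 : (k : ℝ) < κ i := by exact_mod_cast h1
    have : (0 : ℝ) ≤ κ i0 := by positivity
    have : (0 : ℝ) ≤ i0 := by positivity
    linarith
  · have h1 : k ≤ κ i0 + i0 := by
      by_contra hc
      apply hi0 i0 le_rfl
      -- while in the run of ones, F is the map itself
      have key : ∀ j k : ℕ, ∀ y : ℝ, y ∈ Z a (j + k) → (F a)^[j] y ∈ Z a k := by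
        intro j
        induction j with
        | zero => intro k y hy; simpa using hy
        | succ j ih =>
          intro k y hy
          have h0 : tau a y = 0 := tau_eq_of (fun i hi => by omega) (hy 0 (by omega))
          rw [Function.iterate_succ_apply]
          apply ih
          rw [F, h0]
          apply Z_shift
          exact Z_anti (by omega) hy
      have e : i0 = (i0 - i) + i := by omega
      rw [mem_preimage, e, Function.iterate_add_apply]
      apply key
      rw [← e]
      exact Z_anti (by omega) h
    have h2 : (k : ℝ) ≤ κ i0 + i0 := by exact_mod_cast h1
    linarith [hlog i]

lemma rpow_sum_le (s : Finset ℕ) (f : ℕ → ℝ) (hf : ∀ i, 0 ≤ f i) {p : ℝ} (hp0 : 0 < p) (hp : p ≤ 1) :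
    (∑ i ∈ s, f i) ^ p ≤ ∑ i ∈ s, f i ^ p := by
  classical
  induction s using Finset.induction_on with
  | empty => simp [zero_rpow hp0.ne']
  | insert i s hi ih =>
    rw [Finset.sum_insert hi, Finset.sum_insert hi]
    have := Real.rpow_add_le_add_rpow (hf i) (Finset.sum_nonneg fun j _ => hf j : 0 ≤ ∑ j ∈ s, f j) hp0.le hp
    linarith

lemma ae_sum (ha : 1 ≤ a) {ε : ℝ} (hε : 0 < ε) : ∀ᵐ x ∂mu, ∃ c : ℝ, 0 < c ∧ ∀ N : ℕ,
    (S a N x : ℝ) ^ (1 / (a * (1 + ε))) ≤ c * (N : ℝ) ^ (1 + ε) := by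
  set q : ℝ := 1 / (1 + ε) with hq
  have hq1 : q < 1 := by rw [hq, div_lt_one (by linarith)]; linarith
  set g : ℝ → ENNReal := fun y => ENNReal.ofReal (y ^ (-q)) with hg
  have hgm : Measurable g := by
    apply ENNReal.measurable_ofReal.comp
    fun_prop
  have hgi : ∫⁻ y, g y ∂mu ≠ ⊤ := by
    have h1 : IntegrableOn (fun y : ℝ => y ^ (-q)) (Ioo 0 1) :=
      (intervalIntegral.integrableOn_Ioo_rpow_iff one_pos).2 (by linarith)
    have h2 : IntegrableOn (fun y : ℝ => y ^ (-q)) (Ico 0 1) := by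
      rwa [integrableOn_Ico_iff_integrableOn_Ioo]
    exact h2.lintegral_lt_top.ne
  set w : ℕ → ℝ := fun i => 1 / ((i : ℝ) + 1) ^ (1 + ε) with hw
  have hs : Summable w := by
    have := (summable_nat_add_iff 1).2 (summable_one_div_nat_rpow.2 (by linarith : 1 < 1 + ε))
    simpa [hw] using this
  have hw0 : ∀ i, 0 < w i := fun i => by simp only [hw]; positivity
  have hgint : ∀ i : ℕ, ∫⁻ x, g ((F a)^[i] x) ∂mu ≤ C a * ∫⁻ y, g y ∂mu := by
    intro i
    rw [← lintegral_map hgm (measurable_F_iter i), ← smul_eq_mul, ← lintegral_smul_measure]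
    exact lintegral_mono' (map_le ha i) le_rfl
  have hfin : ∫⁻ x, ∑' i, ENNReal.ofReal (w i) * g ((F a)^[i] x) ∂mu ≠ ⊤ := by
    rw [lintegral_tsum]
    · have : ∀ i, ∫⁻ x, ENNReal.ofReal (w i) * g ((F a)^[i] x) ∂mu ≤
          ENNReal.ofReal (w i) * (C a * ∫⁻ y, g y ∂mu) := by
        intro i
        rw [lintegral_const_mul (f := fun x => g ((F a)^[i] x)) _ (hgm.comp (measurable_F_iter i))]
        gcongr
        exact hgint i
      refine ne_top_of_le_ne_top ?_ (ENNReal.tsum_le_tsum this)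
      rw [ENNReal.tsum_mul_right]
      exact ENNReal.mul_ne_top hs.tsum_ofReal_ne_top (ENNReal.mul_ne_top ENNReal.ofReal_ne_top hgi)
    · intro i
      exact ((hgm.comp (measurable_F_iter i)).const_mul _).aemeasurable
  have hae := ae_lt_top (Measurable.tsum fun i =>
    (hgm.comp (measurable_F_iter (a := a) i)).const_mul (ENNReal.ofReal (w i))) hfin
  filter_upwards [hae, ae_G ha] with x hx hxG
  set T := ∑' i, ENNReal.ofReal (w i) * g ((F a)^[i] x) with hT
  set c := T.toReal with hc
  have hpos : ∀ i, 0 < (F a)^[i] x := fun i => G_pos ha (F_iter_mem ha hxG i) 0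
  have hpart : ∀ N : ℕ, ∑ i ∈ Finset.range N, w i * ((F a)^[i] x) ^ (-q) ≤ c := by
    intro N
    have h1 := ENNReal.toReal_mono hx.ne (ENNReal.sum_le_tsum (Finset.range N)
      (f := fun i => ENNReal.ofReal (w i) * g ((F a)^[i] x)))
    rw [ENNReal.toReal_sum] at h1
    · refine le_trans (le_of_eq ?_) h1
      refine Finset.sum_congr rfl fun i _ => ?_
      rw [ENNReal.toReal_mul, ENNReal.toReal_ofReal (hw0 i).le,
        ENNReal.toReal_ofReal (rpow_nonneg (hpos i).le _)]
    · intro i _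
      exact ENNReal.mul_ne_top ENNReal.ofReal_ne_top ENNReal.ofReal_ne_top
  have hc0 : 0 ≤ c := ENNReal.toReal_nonneg
  refine ⟨2 * c + 1, by linarith, fun N => ?_⟩
  set p : ℝ := 1 / (a * (1 + ε)) with hp
  have hae1 : 1 ≤ a * (1 + ε) := by nlinarith
  have hp0 : 0 < p := by positivity
  have hp1 : p ≤ 1 := by rw [hp, div_le_one (by linarith)]; exact hae1
  have hpq : -a * p = -q := by rw [hp, hq]; field_simp
  have hN0 : 0 ≤ (N : ℝ) ^ (1 + ε) := by positivity
  calc (S a N x : ℝ) ^ p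
      = (∑ i ∈ Finset.range N, ((tau a ((F a)^[i] x) + 1 : ℕ) : ℝ)) ^ p := by
        rw [S]; push_cast; rfl
    _ ≤ ∑ i ∈ Finset.range N, ((tau a ((F a)^[i] x) + 1 : ℕ) : ℝ) ^ p :=
        rpow_sum_le _ _ (fun i => by positivity) hp0 hp1
    _ ≤ ∑ i ∈ Finset.range N, 2 * (N : ℝ) ^ (1 + ε) * (w i * ((F a)^[i] x) ^ (-q)) := by
        refine Finset.sum_le_sum fun i hi => ?_
        have h1 := tau_bound ha (F_iter_mem ha hxG i)
        have h2 : (2 : ℝ) ^ p ≤ 2 := by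
          calc (2 : ℝ) ^ p ≤ 2 ^ (1 : ℝ) := rpow_le_rpow_of_exponent_le (by norm_num) hp1
            _ = 2 := by simp
        have h3 : 1 ≤ (N : ℝ) ^ (1 + ε) * w i := by
          simp only [hw]
          rw [mul_one_div, le_div_iff₀ (by positivity), one_mul]
          have : ((i : ℝ) + 1) ≤ N := by exact_mod_cast Finset.mem_range.1 hi
          gcongr
        have h4 : 0 ≤ ((F a)^[i] x) ^ (-q) := rpow_nonneg (hpos i).le _
        calc ((tau a ((F a)^[i] x) + 1 : ℕ) : ℝ) ^ p ≤ (2 * ((F a)^[i] x) ^ (-a)) ^ p := by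
              gcongr
          _ = 2 ^ p * ((F a)^[i] x) ^ (-q) := by
              rw [mul_rpow (by norm_num) (rpow_nonneg (hpos i).le _), ← rpow_mul (hpos i).le, hpq]
          _ ≤ 2 * ((F a)^[i] x) ^ (-q) := by gcongr
          _ = 2 * 1 * ((F a)^[i] x) ^ (-q) := by ring
          _ ≤ 2 * ((N : ℝ) ^ (1 + ε) * w i) * ((F a)^[i] x) ^ (-q) := by gcongr
          _ = _ := by ring
    _ = 2 * (N : ℝ) ^ (1 + ε) * ∑ i ∈ Finset.range N, (w i * ((F a)^[i] x) ^ (-q)) := by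
        rw [Finset.mul_sum]
    _ ≤ 2 * (N : ℝ) ^ (1 + ε) * c := by gcongr; exact hpart N
    _ ≤ _ := by nlinarith

end LSV

namespace LSV
variable {a : ℝ}

lemma runLen_bdd (f : ℝ → ℝ) (A : Set ℝ) (n : ℕ) (x : ℝ) :
    BddAbove {k : ℕ | k ≤ n ∧ ∃ i : ℕ, i + k ≤ n ∧ ∀ m < k, f^[i + m] x ∈ A} :=
  ⟨n, fun _ hk => hk.1⟩

lemma le_runLen {f : ℝ → ℝ} {A : Set ℝ} {n : ℕ} {x : ℝ} {i k : ℕ} (h : i + k ≤ n)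
    (hr : ∀ m < k, f^[i + m] x ∈ A) : k ≤ runLen f A n x :=
  le_csSup (runLen_bdd f A n x) ⟨by omega, i, h, hr⟩

lemma runLen_mem (f : ℝ → ℝ) (A : Set ℝ) (n : ℕ) (x : ℝ) :
    runLen f A n x ≤ n ∧ ∃ i : ℕ, i + runLen f A n x ≤ n ∧
      ∀ m < runLen f A n x, f^[i + m] x ∈ A :=
  Nat.sSup_mem (s := {k : ℕ | k ≤ n ∧ ∃ i : ℕ, i + k ≤ n ∧ ∀ m < k, f^[i + m] x ∈ A})
    ⟨0, by omega, 0, by omega, by intro m hm; omega⟩ (runLen_bdd f A n x)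

lemma ones_le (ha : 1 ≤ a) {x : ℝ} (hx : x ∈ G a) {n N i k : ℕ} (hS : S a N x ≤ n)
    (hik : i + k ≤ N) (hZ : (F a)^[i] x ∈ Z a k) :
    k ≤ runLen (lsv a) (Set.Ico (1 / 2 : ℝ) 1) n x := by
  refine le_runLen (i := S a i x) ?_ ?_
  · have h1 := S_add (a := a) i k x
    have h2 : S a (i + k) x ≤ S a N x := S_mono x hik
    omega
  · intro m hm
    have h := hZ m hm
    rw [F_iter, ← Function.iterate_add_apply] at h
    rw [add_comm]
    exact ⟨h, (iter_mem ha hx.1 _).2⟩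

lemma zeros_le (ha : 1 ≤ a) {x : ℝ} (hx : x ∈ G a) {n N i : ℕ} (hS : S a N x ≤ n)
    (hi : i < N) :
    tau a ((F a)^[i] x) ≤ runLen (lsv a) (Set.Ico (0 : ℝ) (1 / 2)) n x := by
  refine le_runLen (i := S a i x) ?_ ?_
  · have h1 := S_succ (a := a) i x
    have h2 : S a (i + 1) x ≤ S a N x := S_mono x hi
    omega
  · intro m hm
    have h := tau_lt hm
    rw [F_iter, ← Function.iterate_add_apply] at h
    rw [add_comm]
    exact ⟨(iter_mem ha hx.1 _).1, h⟩

lemma runs_upper {x : ℝ} {n N : ℕ} (hS : n < S a (N + 1) x) {c ε : ℝ} (hε : 0 < ε)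
    (hr : ∀ i k : ℕ, (F a)^[i] x ∈ Z a k → (k : ℝ) ≤ c + (1 + ε) * logb 2 (i + 1)) :
    (runLen (lsv a) (Set.Ico (1 / 2 : ℝ) 1) n x : ℝ) ≤
      1 + |c| + (1 + ε) * logb 2 (N + 1) := by
  obtain ⟨-, i, hi, hm⟩ := runLen_mem (lsv a) (Set.Ico (1 / 2 : ℝ) 1) n x
  set k := runLen (lsv a) (Set.Ico (1 / 2 : ℝ) 1) n x with hk
  have hl0 : 0 ≤ logb 2 ((N : ℝ) + 1) := logb_nonneg (by norm_num) (by
    have : (0 : ℝ) ≤ N := by positivity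
    linarith)
  rcases Nat.eq_zero_or_pos k with h0 | h0
  · rw [h0]
    have := abs_nonneg c
    have : 0 ≤ (1 + ε) * logb 2 ((N : ℝ) + 1) := by positivity
    push_cast
    linarith
  obtain ⟨m, hmS⟩ := exists_S (a := a) (x := x) i (by simpa using (hm 0 h0).1)
  have hmN : m ≤ N := by
    by_contra h
    have : S a (N + 1) x ≤ S a m x := S_mono x (by omega)
    omega
  have hZ : (F a)^[m] x ∈ Z a (k - 1) := by
    intro j hj
    rw [F_iter, ← Function.iterate_add_apply, hmS]
    have := (hm (j + 1) (by omega)).1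
    rwa [show i + (j + 1) = j + (i + 1) by ring] at this
  have h1 := hr m (k - 1) hZ
  rw [Nat.cast_sub h0] at h1
  have h2 : logb 2 ((m : ℝ) + 1) ≤ logb 2 ((N : ℝ) + 1) := by
    apply logb_le_logb_of_le (by norm_num) (by positivity)
    have : (m : ℝ) ≤ N := by exact_mod_cast hmN
    linarith
  have h3 : (1 + ε) * logb 2 ((m : ℝ) + 1) ≤ (1 + ε) * logb 2 ((N : ℝ) + 1) := by gcongr
  have := le_abs_self c
  push_cast at h1
  linarith

lemma choose_k {P : ℕ → Prop} (hP : ∀ᶠ k in atTop, P k) {ε : ℝ} (h0 : 0 < ε) (h1 : ε < 1) :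
    ∀ᶠ N : ℕ in atTop, ∃ k : ℕ, (1 - ε) * logb 2 N - 1 ≤ k ∧ 1 ≤ k ∧ k * 2 ^ k * k ≤ N ∧ P k := by
  have hl : Tendsto (fun N : ℕ => logb 2 (N : ℝ)) atTop atTop :=
    (tendsto_logb_atTop (by norm_num)).comp tendsto_natCast_atTop_atTop
  have hk : Tendsto (fun N : ℕ => ⌊(1 - ε) * logb 2 (N : ℝ)⌋₊) atTop atTop :=
    tendsto_nat_floor_atTop.comp (hl.const_mul_atTop (by linarith))
  have hlo : ∀ᶠ x : ℝ in atTop, log x ^ 2 ≤ (log 2) ^ 2 * x ^ ε := by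
    have := (isLittleO_log_rpow_atTop (half_pos h0)).def (c := log 2) (log_pos (by norm_num))
    filter_upwards [this, eventually_ge_atTop 1] with x hx hx1
    rw [norm_of_nonneg (log_nonneg hx1), norm_of_nonneg (by positivity)] at hx
    calc log x ^ 2 ≤ (log 2 * x ^ (ε / 2)) ^ 2 := by
          have := log_nonneg hx1
          gcongr
      _ = (log 2) ^ 2 * x ^ ε := by
          rw [mul_pow, ← rpow_natCast (x ^ (ε / 2)) 2, ← rpow_mul (by linarith)]
          norm_num
  filter_upwards [hk.eventually hP, hk.eventually (eventually_ge_atTop 1),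
    tendsto_natCast_atTop_atTop.eventually hlo, eventually_ge_atTop 1] with N hPk hk1 hN hN1
  have hN1' : (1 : ℝ) ≤ N := by exact_mod_cast hN1
  refine ⟨_, (Nat.sub_one_lt_floor _).le, hk1, ?_, hPk⟩
  set k := ⌊(1 - ε) * logb 2 (N : ℝ)⌋₊ with hkd
  have hlog : 0 ≤ logb 2 (N : ℝ) := logb_nonneg (by norm_num) hN1'
  have hkle : (k : ℝ) ≤ (1 - ε) * logb 2 N := Nat.floor_le (mul_nonneg (by linarith) hlog)
  have hkle' : (k : ℝ) ≤ logb 2 N := by nlinarith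
  have hp : (2 : ℝ) ^ k ≤ (N : ℝ) ^ (1 - ε) := by
    calc (2 : ℝ) ^ k = 2 ^ (k : ℝ) := (rpow_natCast _ _).symm
      _ ≤ 2 ^ ((1 - ε) * logb 2 (N : ℝ)) := rpow_le_rpow_of_exponent_le (by norm_num) hkle
      _ = (N : ℝ) ^ (1 - ε) := by
        rw [mul_comm, rpow_mul (by norm_num), rpow_logb (by norm_num) (by norm_num) (by linarith)]
  have hl2 : logb 2 (N : ℝ) ^ 2 ≤ (N : ℝ) ^ ε := by
    have : (0 : ℝ) < log 2 := log_pos (by norm_num)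
    rw [logb, div_pow, div_le_iff₀ (by positivity), mul_comm]
    exact hN
  have : (k : ℝ) * 2 ^ k * k ≤ N := by
    calc (k : ℝ) * 2 ^ k * k = (k : ℝ) ^ 2 * 2 ^ k := by ring
      _ ≤ logb 2 (N : ℝ) ^ 2 * 2 ^ k := by gcongr
      _ ≤ (N : ℝ) ^ ε * (N : ℝ) ^ (1 - ε) := by gcongr
      _ = N := by rw [← rpow_add (by linarith)]; norm_num
  exact_mod_cast this

lemma ratio_tendsto {u L : ℕ → ℝ} {b : ℝ} (hL : Tendsto L atTop atTop)
    (lo : ∀ δ > 0, δ < 1 → ∃ c, ∀ᶠ n in atTop, (b - δ) * L n - c ≤ u n)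
    (up : ∀ δ > 0, δ < 1 → ∃ c, ∀ᶠ n in atTop, u n ≤ (b + δ) * L n + c) :
    Tendsto (fun n => u n / L n) atTop (nhds b) := by
  rw [Metric.tendsto_atTop']
  intro e he
  set δ := min (e / 2) (1 / 2) with hδ
  have hδ0 : 0 < δ := by positivity
  have hδe : δ ≤ e / 2 := min_le_left _ _
  have hδ1 : δ < 1 := lt_of_le_of_lt (min_le_right _ _) (by norm_num)
  obtain ⟨c, hc⟩ := lo δ hδ0 hδ1
  obtain ⟨d, hd⟩ := up δ hδ0 hδ1
  have key : ∀ᶠ n in atTop, dist (u n / L n) b < e := by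
    filter_upwards [hc, hd, hL.eventually_gt_atTop 0, hL.eventually_gt_atTop (c / (e / 2)),
      hL.eventually_gt_atTop (d / (e / 2))] with n h1 h2 h3 h4 h5
    rw [div_lt_iff₀ (by positivity)] at h4 h5
    rw [Real.dist_eq, abs_lt]
    have h6 : δ * L n ≤ e / 2 * L n := by gcongr
    constructor
    · rw [lt_sub_iff_add_lt, lt_div_iff₀ h3]
      nlinarith
    · rw [sub_lt_iff_lt_add, div_lt_iff₀ h3]
      nlinarith
  obtain ⟨n, hn⟩ := eventually_atTop.1 key
  exact ⟨n, fun m hm => hn m hm.le⟩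

/-- number of completed excursions before time `n` -/
def cnt (a x : ℝ) (n : ℕ) : ℕ := Nat.findGreatest (fun N => S a N x ≤ n) n

lemma S_cnt (x : ℝ) (n : ℕ) : S a (cnt a x n) x ≤ n :=
  Nat.findGreatest_spec (P := fun N => S a N x ≤ n) (Nat.zero_le n) (by simp [S])

lemma lt_S_cnt (x : ℝ) (n : ℕ) : n < S a (cnt a x n + 1) x := by
  by_contra h
  push Not at h
  have h1 := le_S (a := a) (cnt a x n + 1) x
  have := Nat.le_findGreatest (P := fun N => S a N x ≤ n) (le_trans h1 h) h
  unfold cnt at this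
  omega

lemma cnt_tendsto (x : ℝ) : Tendsto (cnt a x) atTop atTop := by
  rw [tendsto_atTop]
  intro M
  filter_upwards [eventually_ge_atTop (S a M x)] with n hn
  exact Nat.le_findGreatest (P := fun N => S a N x ≤ n) (le_trans (le_S M x) hn) hn

lemma logb_succ_le {N : ℕ} (hN : 1 ≤ N) : logb 2 ((N : ℝ) + 1) ≤ logb 2 N + 1 := by
  have h : (1 : ℝ) ≤ N := by exact_mod_cast hN
  calc logb 2 ((N : ℝ) + 1) ≤ logb 2 ((N : ℝ) * 2) :=
        logb_le_logb_of_le (by norm_num) (by positivity) (by linarith)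
    _ = logb 2 N + 1 := by
        rw [logb_mul (by positivity) (by norm_num), logb_self_eq_one (by norm_num)]

lemma det_main (ha : 1 ≤ a) {x : ℝ} (hx : x ∈ G a)
    (hones : ∀ᶠ k in atTop, ∃ i, i + k ≤ k * 2 ^ k * k ∧ (F a)^[i] x ∈ Z a k)
    (hzeros : ∀ᶠ k : ℕ in atTop, ∃ i < k * 2 ^ k, (2 : ℝ) ^ (a * k) ≤ tau a ((F a)^[i] x))
    (hruns : ∀ j : ℕ, ∃ c : ℝ, ∀ i k : ℕ, (F a)^[i] x ∈ Z a k →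
      (k : ℝ) ≤ c + (1 + 1 / ((j : ℝ) + 1)) * logb 2 (i + 1))
    (hsum : ∀ j : ℕ, ∃ c > 0, ∀ N : ℕ, (S a N x : ℝ) ^ (1 / (a * (1 + 1 / ((j : ℝ) + 1)))) ≤
      c * (N : ℝ) ^ (1 + 1 / ((j : ℝ) + 1))) :
      Tendsto (fun n : ℕ =>
          ((runLen (lsv a) (Set.Ico (1 / 2 : ℝ) 1) n x : ℕ) : ℝ) / Real.logb 2 n)
        atTop (nhds (1 / a)) ∧
      Tendsto (fun n : ℕ =>
          Real.log ((runLen (lsv a) (Set.Ico (0 : ℝ) (1 / 2)) n x : ℕ) : ℝ) /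
            Real.log n)
        atTop (nhds 1) := by
  set L : ℕ → ℝ := fun n => logb 2 (cnt a x n : ℝ) with hLd
  have hL : Tendsto L atTop atTop :=
    (tendsto_logb_atTop (by norm_num)).comp (tendsto_natCast_atTop_atTop.comp (cnt_tendsto x))
  have hc1 := (cnt_tendsto (a := a) x).eventually (eventually_ge_atTop 1)
  -- ones
  have t1 : Tendsto (fun n => ((runLen (lsv a) (Set.Ico (1 / 2 : ℝ) 1) n x : ℕ) : ℝ) / L n)
      atTop (nhds 1) := by
    refine ratio_tendsto hL ?_ ?_
    · intro δ h0 h1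
      refine ⟨1, ?_⟩
      filter_upwards [(cnt_tendsto (a := a) x).eventually (choose_k hones h0 h1)]
        with n ⟨k, hk, hk1, hkN, i, hik, hZ⟩
      have := ones_le ha hx (S_cnt x n) (le_trans hik hkN) hZ
      have : (k : ℝ) ≤ (runLen (lsv a) (Set.Ico (1 / 2 : ℝ) 1) n x : ℝ) := by exact_mod_cast this
      exact le_trans hk this
    · intro δ h0 h1
      obtain ⟨j, hj⟩ := exists_nat_one_div_lt h0
      obtain ⟨c, hc⟩ := hruns j
      refine ⟨1 + |c| + (1 + δ), ?_⟩
      filter_upwards [hc1] with n hn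
      have h2 := runs_upper (lt_S_cnt (a := a) x n) (by positivity) hc
      have h3 := logb_succ_le hn
      have h4 : 0 ≤ logb 2 ((cnt a x n : ℝ) + 1) := logb_nonneg (by norm_num) (by
        have : (0 : ℝ) ≤ cnt a x n := by positivity
        linarith)
      have h5 : (1 + 1 / ((j : ℝ) + 1)) * logb 2 ((cnt a x n : ℝ) + 1) ≤
          (1 + δ) * logb 2 ((cnt a x n : ℝ) + 1) := by gcongr
      have h6 : (1 + δ) * logb 2 ((cnt a x n : ℝ) + 1) ≤ (1 + δ) * (L n + 1) := by
        gcongr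
      linarith
  -- lower bound for zeros
  have hlow : ∀ δ > 0, δ < 1 → ∃ c, ∀ᶠ n in atTop, (a - δ) * L n - c ≤
      logb 2 (runLen (lsv a) (Set.Ico (0 : ℝ) (1 / 2)) n x : ℝ) := by
    intro δ h0 h1
    refine ⟨a, ?_⟩
    have ha0 : 0 < a := by linarith
    filter_upwards [(cnt_tendsto (a := a) x).eventually (choose_k hzeros
      (div_pos h0 ha0) ((div_lt_one ha0).2 (by linarith)))]
      with n ⟨k, hk, hk1, hkN, i, hik, hZ⟩
    have h2 := zeros_le ha hx (S_cnt x n) (i := i) (by nlinarith)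
    have h3 : (2 : ℝ) ^ (a * k) ≤ (runLen (lsv a) (Set.Ico (0 : ℝ) (1 / 2)) n x : ℝ) :=
      le_trans hZ (by exact_mod_cast h2)
    have h4 : a * k ≤ logb 2 (runLen (lsv a) (Set.Ico (0 : ℝ) (1 / 2)) n x : ℝ) := by
      rw [le_logb_iff_rpow_le (by norm_num) (lt_of_lt_of_le (by positivity) h3)]
      exact h3
    have h5 : a * ((1 - δ / a) * L n - 1) ≤ a * k := by gcongr
    have h6 : a * ((1 - δ / a) * L n - 1) = (a - δ) * L n - a := by field_simp
    linarith
  have hmid : ∀ n : ℕ, logb 2 (runLen (lsv a) (Set.Ico (0 : ℝ) (1 / 2)) n x : ℝ) ≤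
      logb 2 (n : ℝ) := by
    intro n
    have h := (runLen_mem (lsv a) (Set.Ico (0 : ℝ) (1 / 2)) n x).1
    rcases Nat.eq_zero_or_pos (runLen (lsv a) (Set.Ico (0 : ℝ) (1 / 2)) n x) with h0 | h0
    · rw [h0]
      rcases Nat.eq_zero_or_pos n with h1 | h1
      · simp [h1]
      · have : (1 : ℝ) ≤ n := by exact_mod_cast h1
        simpa using logb_nonneg (by norm_num) this
    · exact logb_le_logb_of_le (by norm_num) (by exact_mod_cast h0) (by exact_mod_cast h)
  have hup : ∀ δ > 0, δ < 1 → ∃ c, ∀ᶠ n : ℕ in atTop, logb 2 (n : ℝ) ≤ (a + δ) * L n + c := by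
    intro δ h0 h1
    have ha0 : 0 < a := by linarith
    obtain ⟨j, hj⟩ := exists_nat_one_div_lt (show 0 < δ / (3 * a) by positivity)
    obtain ⟨c, hc0, hc⟩ := hsum j
    set ε := 1 / ((j : ℝ) + 1) with hε
    have hε0 : 0 < ε := by positivity
    have hε1 : ε ≤ 1 := by
      rw [hε, div_le_one (by positivity)]
      have : (0 : ℝ) ≤ j := by positivity
      linarith
    have hεδ : ε * (3 * a) ≤ δ := by
      have := (lt_div_iff₀ (by positivity)).1 hj
      linarith
    have hcoef : a * (1 + ε) * (1 + ε) ≤ a + δ := by nlinarith [mul_pos ha0 hε0]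
    refine ⟨a * (1 + ε) * logb 2 c + (a + δ), ?_⟩
    filter_upwards [hc1, eventually_ge_atTop 1] with n hn hn1
    have hn1' : (1 : ℝ) ≤ n := by exact_mod_cast hn1
    have h2 : (n : ℝ) ≤ S a (cnt a x n + 1) x := by exact_mod_cast (lt_S_cnt x n).le
    have h3 := hc (cnt a x n + 1)
    have h4 : (n : ℝ) ^ (1 / (a * (1 + ε))) ≤ c * ((cnt a x n + 1 : ℕ) : ℝ) ^ (1 + ε) :=
      le_trans (by gcongr) h3
    have h5 := logb_le_logb_of_le (b := 2) (by norm_num) (by positivity) h4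
    have hpos : (0 : ℝ) < ((cnt a x n + 1 : ℕ) : ℝ) := by positivity
    rw [logb_mul hc0.ne' (by positivity), logb_rpow_eq_mul_logb_of_pos (by linarith),
      logb_rpow_eq_mul_logb_of_pos hpos] at h5
    push_cast at h5
    have h6 := logb_succ_le hn
    have hL0 : 0 ≤ L n := logb_nonneg (by norm_num) (by exact_mod_cast hn)
    have h7 : logb 2 (n : ℝ) = (a * (1 + ε)) * (1 / (a * (1 + ε)) * logb 2 (n : ℝ)) := by
      field_simp
    rw [h7]
    calc (a * (1 + ε)) * (1 / (a * (1 + ε)) * logb 2 (n : ℝ))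
        ≤ (a * (1 + ε)) * (logb 2 c + (1 + ε) * (L n + 1)) := by
          gcongr
          refine h5.trans ?_
          gcongr
      _ = (a * (1 + ε) * (1 + ε)) * (L n + 1) + a * (1 + ε) * logb 2 c := by ring
      _ ≤ (a + δ) * (L n + 1) + a * (1 + ε) * logb 2 c := by gcongr
      _ = _ := by ring
  have t2 : Tendsto (fun n : ℕ => logb 2 (n : ℝ) / L n) atTop (nhds a) := by
    refine ratio_tendsto hL ?_ hup
    intro δ h0 h1
    obtain ⟨c, hc⟩ := hlow δ h0 h1
    exact ⟨c, hc.mono fun n hn => hn.trans (hmid n)⟩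
  have t3 : Tendsto (fun n : ℕ =>
      logb 2 (runLen (lsv a) (Set.Ico (0 : ℝ) (1 / 2)) n x : ℝ) / L n) atTop (nhds a) := by
    refine ratio_tendsto hL hlow ?_
    intro δ h0 h1
    obtain ⟨c, hc⟩ := hup δ h0 h1
    exact ⟨c, hc.mono fun n hn => (hmid n).trans hn⟩
  have ha0 : a ≠ 0 := by linarith
  constructor
  · refine (t1.div t2 ha0).congr' ?_
    filter_upwards [hL.eventually_gt_atTop 0] with n hn
    exact div_div_div_cancel_right₀ hn.ne' _ _
  · have := t3.div t2 ha0
    rw [div_self ha0] at this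
    refine this.congr' ?_
    filter_upwards [hL.eventually_gt_atTop 0] with n hn
    have hl2 : log 2 ≠ 0 := (log_pos (by norm_num)).ne'
    simp only [Pi.div_apply]
    rw [div_div_div_cancel_right₀ hn.ne', logb, logb, div_div_div_cancel_right₀ hl2]

theorem ae_main (ha : 1 ≤ a) : ∀ᵐ x ∂mu,
      Tendsto (fun n : ℕ =>
          ((runLen (lsv a) (Set.Ico (1 / 2 : ℝ) 1) n x : ℕ) : ℝ) / Real.logb 2 n)
        atTop (nhds (1 / a)) ∧
      Tendsto (fun n : ℕ =>
          Real.log ((runLen (lsv a) (Set.Ico (0 : ℝ) (1 / 2)) n x : ℕ) : ℝ) /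
            Real.log n)
        atTop (nhds 1) := by
  have h1 := ae_all_iff.2 fun j : ℕ =>
    ae_runs (a := a) ha (ε := 1 / ((j : ℝ) + 1)) (by positivity)
  have h2 := ae_all_iff.2 fun j : ℕ =>
    ae_sum (a := a) ha (ε := 1 / ((j : ℝ) + 1)) (by positivity)
  filter_upwards [ae_G ha, ae_ones ha, ae_zeros ha, h1, h2] with x hx ho hz hr hs
  exact det_main ha hx ho hz hr hs

end LSV

/-- Theorem: run length asymptotics for the intermittent map with `α ≥ 1`:
`ξ_n^{(1)}(x)/log₂ n → 1/α` and `log ξ_n^{(0)}(x)/log n → 1`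
for Lebesgue-a.e. `x`. -/
theorem lsv_run_length
    (a : ℝ) (ha : 1 ≤ a) :
    ∀ᵐ x ∂(volume.restrict (Set.Ico (0 : ℝ) 1)),
      Tendsto (fun n : ℕ =>
          ((runLen (lsv a) (Set.Ico (1 / 2 : ℝ) 1) n x : ℕ) : ℝ) / Real.logb 2 n)
        atTop (nhds (1 / a)) ∧
      Tendsto (fun n : ℕ =>
          Real.log ((runLen (lsv a) (Set.Ico (0 : ℝ) (1 / 2)) n x : ℕ) : ℝ) /
            Real.log n)
        atTop (nhds 1) := by
  exact LSV.ae_main ha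
end
end

section
/- Let θ be an irrational number of Diophantine type γ = γ(θ) < ∞, and let f_θ : S¹ → S¹ be the rotation of the circle S¹ = ℝ/ℤ by θ, which preserves Lebesgue measure. Let β > 1 satisfy 1/γ < 1 − 1/β, and consider the non-integrable observable ψ(x) = d(x,0)^{−β}, where d is the standard metric on S¹. Then for Lebesgue-almost every x ∈ S¹, liminf_{n→∞} log S_n^ψ(x)/log n ≤ 1 + β/γ < β ≤ limsup_{n→∞} log S_n^ψ(x)/log n, where S_n^ψ(x) = Σ_{k=0}^{n−1} ψ(f_θ^k(x)). -/
open MeasureTheory Filter Set Real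

noncomputable section

/-- Distance from `t` to the nearest integer. -/
def natDist (t : ℝ) : ℝ := |t - round t|

/-- The set of exponents `β` such that `liminf_q q^β ‖qθ‖ > 0`; the Diophantine
type of `θ` is the infimum of this set. -/
def dioSet (θ : ℝ) : Set ℝ :=
  {b : ℝ | ∃ c : ℝ, 0 < c ∧ ∀ᶠ q : ℕ in atTop, c ≤ (q : ℝ) ^ b * natDist (q * θ)}

/-- Rotation of the circle `S¹ = ℝ/ℤ` by the angle `θ`. -/
def rot (θ : ℝ) (x : AddCircle (1 : ℝ)) : AddCircle (1 : ℝ) :=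
  x + (θ : AddCircle (1 : ℝ))

/-- Birkhoff sum `S_n(x) = ∑_{k=0}^{n-1} φ(f^k x)`. -/
def birkSum {X : Type*} (f : X → X) (φ : X → ℝ) (n : ℕ) (x : X) : ℝ :=
  ∑ k ∈ Finset.range n, φ (f^[k] x)

open MeasureTheory Filter Set Real

lemma rot_iter (θ : ℝ) (k : ℕ) (x : AddCircle (1 : ℝ)) :
    (rot θ)^[k] x = x + ((k * θ : ℝ) : AddCircle (1 : ℝ)) := by
  induction k with
  | zero => simp
  | succ k ih =>
    rw [Function.iterate_succ_apply', ih, rot, add_assoc, ← AddCircle.coe_add]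
    congr 2
    push_cast
    ring

lemma norm_coe_le_sub (y : ℝ) (t : ℤ) : ‖(y : AddCircle (1 : ℝ))‖ ≤ |y - t| := by
  have h : ‖(y : AddCircle (1 : ℝ))‖ = |y - round y| := UnitAddCircle.norm_eq
  rw [h]
  exact round_le y t

lemma natDist_eq_norm (y : ℝ) : natDist y = ‖(y : AddCircle (1 : ℝ))‖ := by
  have h : ‖(y : AddCircle (1 : ℝ))‖ = |y - round y| := UnitAddCircle.norm_eq
  rw [h, natDist]

/-- Infinitely many good rational approximations, with unbounded denominators. -/
lemma frequently_dirichlet (θ : ℝ) (hθ : Irrational θ) :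
    ∃ᶠ q : ℕ in atTop, 0 < q ∧ ∃ p : ℤ, IsCoprime p (q : ℤ) ∧
      |θ - p / q| < 1 / (q : ℝ) ^ 2 := by
  rw [frequently_atTop]
  intro N
  by_contra! hcon
  apply Real.infinite_rat_abs_sub_lt_one_div_den_sq_of_irrational hθ
  obtain ⟨M, hM⟩ := exists_nat_gt ((|θ| + 1) * N)
  refine Set.Finite.subset
    (((Finset.Icc (-(M : ℤ)) M ×ˢ Finset.range N).image
      (fun a : ℤ × ℕ => ((a.1 : ℚ) / a.2))).finite_toSet) ?_
  intro r hr
  simp only [Set.mem_ofPred_eq] at hr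
  have hden : (0 : ℝ) < r.den := by exact_mod_cast r.den_pos
  have hr' : (r : ℝ) = (r.num : ℝ) / (r.den : ℝ) := by exact_mod_cast (Rat.num_div_den r).symm
  have hlt : r.den < N := by
    by_contra hge
    have := hcon r.den (not_lt.mp hge) r.den_pos r.num
      (by
        rw [Int.isCoprime_iff_nat_coprime]
        simpa using r.reduced)
    rw [← hr'] at this
    exact absurd hr (not_lt.mpr this)
  simp only [Finset.coe_image, Set.mem_image]
  refine ⟨(r.num, r.den), ?_, by exact_mod_cast Rat.num_div_den r⟩
  have h1 : 1 / (r.den : ℝ) ^ 2 ≤ 1 := by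
    have h1d : (1 : ℝ) ≤ r.den := by exact_mod_cast r.den_pos
    rw [div_le_one (by positivity)]
    nlinarith
  have h2 : |(r : ℝ)| ≤ |θ| + 1 := by
    have h3 := abs_sub_abs_le_abs_sub (r : ℝ) θ
    rw [abs_sub_comm] at h3
    linarith
  have h3 : |(r.num : ℝ)| ≤ M := by
    have h4 : (r.num : ℝ) = r * r.den := by rw [hr']; field_simp
    rw [h4, abs_mul, abs_of_pos hden]
    have h5 : (r.den : ℝ) ≤ N := by exact_mod_cast hlt.le
    have := mul_le_mul h2 h5 hden.le (by positivity)
    linarith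
  have h4 : |r.num| ≤ (M : ℤ) := by exact_mod_cast h3
  rw [abs_le] at h4
  simp [h4.1, h4.2, hlt]

/-- Every exponent in `dioSet` is at least one. -/
lemma one_le_of_mem_dioSet (θ : ℝ) (hθ : Irrational θ) (s : ℝ) (hs : s ∈ dioSet θ) : 1 ≤ s := by
  by_contra hlt
  push Not at hlt
  obtain ⟨c, hc, hev⟩ := hs
  have ht : Tendsto (fun q : ℕ => (q : ℝ) ^ (-(1 - s))) atTop (nhds 0) :=
    (tendsto_rpow_neg_atTop (by linarith)).comp tendsto_natCast_atTop_atTop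
  have hev2 := ht.eventually (gt_mem_nhds hc)
  obtain ⟨q, ⟨hq, p, -, hp⟩, h1, h2⟩ :=
    ((frequently_dirichlet θ hθ).and_eventually (hev.and hev2)).exists
  have hq' : (0 : ℝ) < q := by exact_mod_cast hq
  have h3 : natDist (q * θ) ≤ (q : ℝ) ^ (-1 : ℝ) := by
    rw [natDist_eq_norm]
    refine (norm_coe_le_sub _ p).trans ?_
    have h4 : (q : ℝ) * θ - p = q * (θ - p / q) := by field_simp
    rw [h4, abs_mul, abs_of_pos hq', Real.rpow_neg_one]
    calc (q : ℝ) * |θ - p / q| ≤ q * (1 / (q : ℝ) ^ 2) := by gcongr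
      _ = (q : ℝ)⁻¹ := by field_simp
  have h4 : (q : ℝ) ^ s * natDist (q * θ) ≤ (q : ℝ) ^ (-(1 - s)) := by
    calc _ ≤ (q : ℝ) ^ s * (q : ℝ) ^ (-1 : ℝ) := by gcongr
      _ = _ := by rw [← Real.rpow_add hq']; congr 1; ring
  linarith

lemma ae_orbit_ne_zero (θ : ℝ) :
    ∀ᵐ x ∂(volume : Measure (AddCircle (1 : ℝ))), ∀ k : ℕ, (rot θ)^[k] x ≠ 0 := by
  rw [ae_all_iff]
  intro k
  rw [ae_iff]
  refine measure_mono_null (t := Metric.closedBall (-((k * θ : ℝ) : AddCircle (1 : ℝ))) 0) ?_ ?_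
  · intro x hx
    simp only [ne_eq, not_not, Set.mem_ofPred_eq, rot_iter] at hx
    rw [Metric.closedBall_zero, Set.mem_singleton_iff]
    exact eq_neg_of_add_eq_zero_left hx
  · rw [AddCircle.volume_closedBall]
    simp

/-- Inhomogeneous approximation: the orbit comes within `3/q` of zero at a time in `[q, 2q)`. -/
lemma exists_close (θ : ℝ) (q : ℕ) (hq : 0 < q) (p : ℤ) (hpq : IsCoprime p (q : ℤ))
    (h : |θ - p / q| < 1 / (q : ℝ) ^ 2) (x : AddCircle (1 : ℝ)) :
    ∃ j : ℕ, j < 2 * q ∧ ‖(rot θ)^[j] x‖ ≤ 3 / q := by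
  induction x using QuotientAddGroup.induction_on with
  | H y =>
  have hq' : (0 : ℝ) < q := by exact_mod_cast hq
  have hqz : (0 : ℤ) < q := by exact_mod_cast hq
  obtain ⟨u, v, huv⟩ := hpq
  set m : ℤ := ⌊(q : ℝ) * y⌋ with hm
  have hj0 := Int.emod_nonneg (-m * u) hqz.ne'
  have hj1 := Int.emod_lt_of_pos (-m * u) hqz
  obtain ⟨j, hj⟩ := Int.eq_ofNat_of_zero_le hj0
  have hjq : j < q := by omega
  have hdiv := Int.emod_add_mul_ediv (-m * u) q
  rw [hj] at hdiv
  have hsum : (j : ℤ) * p + m = q * (v * m - p * ((-m * u) / q)) := by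
    have h1 : (j : ℤ) = -m * u - q * ((-m * u) / q) := by linarith
    rw [h1]
    linear_combination (-m) * huv
  set t : ℤ := v * m - p * ((-m * u) / q) with ht
  refine ⟨j, by omega, ?_⟩
  rw [rot_iter]
  change ‖((y : ℝ) : AddCircle (1 : ℝ)) + ((j * θ : ℝ) : AddCircle (1 : ℝ))‖ ≤ 3 / q
  rw [← AddCircle.coe_add]
  refine (norm_coe_le_sub _ t).trans ?_
  have hsumR : (j : ℝ) * p + m = q * t := by exact_mod_cast hsum
  have e : y + j * θ - t = (y - m / q) + j * (θ - p / q) := by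
    field_simp
    linarith
  rw [e]
  refine (abs_add_le _ _).trans ?_
  have h1 : |y - m / q| ≤ 1 / q := by
    have e2 : y - m / q = (q * y - m) / q := by field_simp
    rw [e2, abs_div, abs_of_pos hq']
    gcongr
    rw [abs_le]
    have := Int.floor_le ((q : ℝ) * y)
    have := Int.lt_floor_add_one ((q : ℝ) * y)
    constructor <;> linarith
  have h2 : |(j : ℝ) * (θ - p / q)| ≤ 1 / q := by
    have hjR : (j : ℝ) ≤ q := by exact_mod_cast hjq.le
    rw [abs_mul, abs_of_nonneg (by positivity)]
    calc (j : ℝ) * |θ - p / q| ≤ q * (1 / (q : ℝ) ^ 2) := by gcongr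
      _ = 1 / q := by field_simp
  have h3 : (3 : ℝ) / q = 1 / q + 1 / q + 1 / q := by ring
  have h4 : 0 < 1 / (q : ℝ) := by positivity
  linarith

lemma limsup_part (θ : ℝ) (hθ : Irrational θ) (b : ℝ) (hb : 1 < b) (x : AddCircle (1 : ℝ))
    (hx : ∀ k : ℕ, (rot θ)^[k] x ≠ 0) :
    ((b : ℝ) : EReal)
        ≤ limsup (fun n : ℕ =>
            ((Real.log (birkSum (rot θ) (fun z => ‖z‖ ^ (-b)) n x) /
              Real.log n : ℝ) : EReal)) atTop := by
  have key : ∀ a : ℝ, a < b → ((a : ℝ) : EReal)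
        ≤ limsup (fun n : ℕ =>
            ((Real.log (birkSum (rot θ) (fun z => ‖z‖ ^ (-b)) n x) /
              Real.log n : ℝ) : EReal)) atTop := by
    intro a hab
    apply le_limsup_of_frequently_le'
    have hlog : Tendsto (fun q : ℕ => Real.log q) atTop atTop :=
      Real.tendsto_log_atTop.comp tendsto_natCast_atTop_atTop
    have hev := (hlog.eventually_ge_atTop
      ((b * Real.log 3 + a * Real.log 2) / (b - a))).and (hlog.eventually_gt_atTop 0)
    have hf := (frequently_dirichlet θ hθ).and_eventually hev
    have ht : Tendsto (fun q : ℕ => 2 * q) atTop atTop :=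
      tendsto_id.const_mul_atTop' (by norm_num)
    refine ht.frequently (hf.mono ?_)
    rintro q ⟨⟨hq, p, hpq, hp⟩, hL, hL0⟩
    obtain ⟨j, hj, hclose⟩ := exists_close θ q hq p hpq hp x
    have hq' : (0 : ℝ) < q := by exact_mod_cast hq
    have hge : (3 / q : ℝ) ^ (-b) ≤ birkSum (rot θ) (fun z => ‖z‖ ^ (-b)) (2 * q) x := by
      refine (Real.rpow_le_rpow_of_nonpos (norm_pos_iff.mpr (hx j)) hclose (by linarith)).trans ?_
      exact Finset.single_le_sum (f := fun k => ‖(rot θ)^[k] x‖ ^ (-b))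
        (fun k _ => by positivity) (Finset.mem_range.mpr hj)
    have hlg : b * (Real.log q - Real.log 3)
        ≤ Real.log (birkSum (rot θ) (fun z => ‖z‖ ^ (-b)) (2 * q) x) := by
      refine le_trans (le_of_eq ?_) (Real.log_le_log (by positivity) hge)
      rw [Real.log_rpow (by positivity), Real.log_div (by norm_num) hq'.ne']
      ring
    rw [EReal.coe_le_coe_iff]
    have hl2 : 0 < Real.log 2 := Real.log_pos (by norm_num)
    push_cast
    rw [Real.log_mul (by norm_num) hq'.ne', le_div_iff₀ (by linarith)]
    rw [div_le_iff₀ (by linarith)] at hL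
    nlinarith
  have hcont : Tendsto (fun m : ℕ => ((b - 1 / ((m : ℝ) + 1) : ℝ) : EReal)) atTop
      (nhds ((b : ℝ) : EReal)) := by
    apply (continuous_coe_real_ereal.tendsto b).comp
    simpa using (tendsto_const_nhds (x := b)).sub tendsto_one_div_add_atTop_nhds_zero_nat
  refine le_of_tendsto' hcont fun m => key _ ?_
  have : 0 < 1 / ((m : ℝ) + 1) := by positivity
  linarith

/-- For fixed exponents `t < s` with `s ∉ dioSet θ`, an explicit almost sure liminf bound. -/
lemma liminf_part (θ : ℝ) (s t : ℝ) (hs : s ∉ dioSet θ) (ht : 0 < t) (hts : t < s)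
    (b : ℝ) (hb : 1 < b) :
    ∀ᵐ x ∂(volume : Measure (AddCircle (1 : ℝ))),
      liminf (fun n : ℕ =>
          ((Real.log (birkSum (rot θ) (fun z => ‖z‖ ^ (-b)) n x) /
            Real.log n : ℝ) : EReal)) atTop
        ≤ ((1 + (1 + (s - t)) * b / t : ℝ) : EReal) := by
  set η := s - t with hη
  have hη0 : 0 < η := by linarith
  have hfreq : ∃ᶠ q : ℕ in atTop, (q : ℝ) ^ s * natDist (q * θ) < 1 := by
    intro hcon
    apply hs
    refine ⟨1, one_pos, hcon.mono fun q hq => ?_⟩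
    exact not_lt.mp hq
  -- almost every point is infinitely often good
  have hgood : ∀ᵐ x ∂(volume : Measure (AddCircle (1 : ℝ))),
      ∃ᶠ q : ℕ in atTop, (q : ℝ) ^ s * natDist (q * θ) < 1 ∧
        2 * (q : ℝ) ^ (-η) < ‖q • x‖ := by
    have : ∀ᵐ x ∂(volume : Measure (AddCircle (1 : ℝ))), ∀ N : ℕ, ∃ q ≥ N,
        (q : ℝ) ^ s * natDist (q * θ) < 1 ∧ 2 * (q : ℝ) ^ (-η) < ‖q • x‖ := by
      rw [ae_all_iff]
      intro N
      rw [ae_iff]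
      have h0 : Tendsto (fun q : ℕ => ENNReal.ofReal (2 * (2 * (q : ℝ) ^ (-η)))) atTop
          (nhds 0) := by
        have h1 : Tendsto (fun q : ℕ => (q : ℝ) ^ (-η)) atTop (nhds 0) :=
          (tendsto_rpow_neg_atTop hη0).comp tendsto_natCast_atTop_atTop
        have h2 := ENNReal.tendsto_ofReal ((h1.const_mul 2).const_mul 2)
        simpa using h2
      refine le_antisymm ?_ bot_le
      refine ge_of_tendsto_of_frequently h0 ?_
      refine (hfreq.and_eventually ((eventually_ge_atTop N).and
        (eventually_gt_atTop 1))).mono ?_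
      rintro q ⟨hq1, hqN, hq2⟩
      calc volume {x : AddCircle (1 : ℝ) | ¬ ∃ q ≥ N,
            (q : ℝ) ^ s * natDist (q * θ) < 1 ∧ 2 * (q : ℝ) ^ (-η) < ‖q • x‖}
          ≤ volume ((fun y : AddCircle (1 : ℝ) => q • y) ⁻¹'
              Metric.closedBall 0 (2 * (q : ℝ) ^ (-η))) := by
            apply measure_mono
            intro x hx
            simp only [Set.mem_ofPred_eq] at hx
            push Not at hx
            simpa using hx q hqN hq1
        _ = volume (Metric.closedBall (0 : AddCircle (1 : ℝ)) (2 * (q : ℝ) ^ (-η))) :=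
            (AddCircle.ergodic_nsmul hq2).toMeasurePreserving.measure_preimage
              Metric.isClosed_closedBall.measurableSet.nullMeasurableSet
        _ ≤ _ := by
            rw [AddCircle.volume_closedBall]
            exact ENNReal.ofReal_le_ofReal (min_le_right _ _)
    filter_upwards [this] with x hx
    exact frequently_atTop.mpr hx
  filter_upwards [hgood] with x hx
  apply liminf_le_of_frequently_le'
  have hn : Tendsto (fun q : ℕ => ⌈(q : ℝ) ^ t⌉₊) atTop atTop :=
    tendsto_nat_ceil_atTop.comp ((tendsto_rpow_atTop ht).comp tendsto_natCast_atTop_atTop)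
  refine hn.frequently ((hx.and_eventually (eventually_gt_atTop 1)).mono ?_)
  rintro q ⟨⟨h1, h2⟩, hq⟩
  have hq1 : (1 : ℝ) < q := by exact_mod_cast hq
  have hq0 : (0 : ℝ) < q := by linarith
  set n := ⌈(q : ℝ) ^ t⌉₊ with hndef
  have hqn : (q : ℝ) ^ t ≤ n := Nat.le_ceil _
  have hqt1 : 1 < (q : ℝ) ^ t := Real.one_lt_rpow hq1 ht
  have hn1 : (1 : ℝ) < n := by linarith
  have hlogq : 0 < Real.log q := Real.log_pos hq1
  have hlogn : 0 < Real.log n := Real.log_pos hn1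
  have hlog : t * Real.log q ≤ Real.log n := by
    rw [← Real.log_rpow hq0]
    exact Real.log_le_log (by positivity) hqn
  have hterm : ∀ k ∈ Finset.range n,
      ‖(rot θ)^[k] x‖ ^ (-b) ≤ (q : ℝ) ^ ((1 + η) * b) := by
    intro k hk
    have hk' : (k : ℝ) < (q : ℝ) ^ t := Nat.lt_ceil.mp (Finset.mem_range.mp hk)
    have hlow : (q : ℝ) ^ (-(1 + η)) ≤ ‖(rot θ)^[k] x‖ := by
      have e : q • (rot θ)^[k] x = q • x + k • ((q * θ : ℝ) : AddCircle (1 : ℝ)) := by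
        rw [rot_iter, smul_add, ← AddCircle.coe_nsmul, ← AddCircle.coe_nsmul]
        congr 2
        simp only [nsmul_eq_mul]
        ring
      have h3 : ‖q • (rot θ)^[k] x‖ ≤ q * ‖(rot θ)^[k] x‖ := norm_nsmul_le
      have h4 : ‖k • ((q * θ : ℝ) : AddCircle (1 : ℝ))‖ ≤ (q : ℝ) ^ (-η) := by
        refine norm_nsmul_le.trans ?_
        rw [← natDist_eq_norm]
        have h5 : natDist (q * θ) ≤ (q : ℝ) ^ (-s) := by
          rw [Real.rpow_neg hq0.le, ← one_div, le_div_iff₀ (by positivity)]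
          linarith
        have h6 : 0 ≤ natDist (q * θ) := abs_nonneg _
        calc (k : ℝ) * natDist (q * θ) ≤ (q : ℝ) ^ t * (q : ℝ) ^ (-s) := by gcongr
          _ = (q : ℝ) ^ (-η) := by rw [← Real.rpow_add hq0]; congr 1; rw [hη]; ring
      have h5 : ‖q • x‖ ≤ ‖q • (rot θ)^[k] x‖ + ‖k • ((q * θ : ℝ) : AddCircle (1 : ℝ))‖ := by
        have e2 : q • x = q • (rot θ)^[k] x - k • ((q * θ : ℝ) : AddCircle (1 : ℝ)) := by
          rw [e]; abel
        rw [e2]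
        exact norm_sub_le _ _
      have h6 : (q : ℝ) ^ (-(1 + η)) * q = (q : ℝ) ^ (-η) := by
        rw [← Real.rpow_add_one hq0.ne']; congr 1; ring
      have h7 : (q : ℝ) ^ (-(1 + η)) * q ≤ ‖(rot θ)^[k] x‖ * q := by
        rw [h6]; linarith
      exact le_of_mul_le_mul_right h7 hq0
    calc ‖(rot θ)^[k] x‖ ^ (-b) ≤ ((q : ℝ) ^ (-(1 + η))) ^ (-b) :=
          Real.rpow_le_rpow_of_nonpos (by positivity) hlow (by linarith)
      _ = _ := by rw [← Real.rpow_mul hq0.le]; congr 1; ring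
  have hS : birkSum (rot θ) (fun z => ‖z‖ ^ (-b)) n x ≤ n * (q : ℝ) ^ ((1 + η) * b) := by
    have := Finset.sum_le_card_nsmul _ _ _ hterm
    simpa [birkSum] using this
  have hS0 : 0 ≤ birkSum (rot θ) (fun z => ‖z‖ ^ (-b)) n x :=
    Finset.sum_nonneg fun k _ => by positivity
  have hlogS : Real.log (birkSum (rot θ) (fun z => ‖z‖ ^ (-b)) n x)
      ≤ Real.log n + (1 + η) * b * Real.log q := by
    rcases hS0.eq_or_lt with h0 | hpos
    · rw [← h0, Real.log_zero]
      positivity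
    · refine (Real.log_le_log hpos hS).trans (le_of_eq ?_)
      rw [Real.log_mul (by positivity) (by positivity), Real.log_rpow hq0]
  rw [EReal.coe_le_coe_iff, div_le_iff₀ hlogn]
  have h8 : (1 + η) * b * Real.log q ≤ (1 + η) * b / t * Real.log n := by
    have : (1 + η) * b * Real.log q = (1 + η) * b / t * (t * Real.log q) := by field_simp
    rw [this]
    gcongr
  linarith

/-- Proposition: strongly oscillating Birkhoff sums of the infinite observable
`ψ(x) = d(x,0)^{−β}` for a circle rotation of finite Diophantine type `γ`,
when `β > 1` and `1/γ < 1 − 1/β`. -/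
theorem rotation_oscillating_birkhoff_sums
    (θ : ℝ) (hθ : Irrational θ)
    (hfin : (dioSet θ).Nonempty)
    (γ : ℝ) (hγ : γ = sInf (dioSet θ))
    (b : ℝ) (hb : 1 < b) (hbγ : 1 / γ < 1 - 1 / b) :
    ∀ᵐ x ∂(volume : Measure (AddCircle (1 : ℝ))),
      liminf (fun n : ℕ =>
          ((Real.log (birkSum (rot θ) (fun z => ‖z‖ ^ (-b)) n x) /
            Real.log n : ℝ) : EReal)) atTop
        ≤ ((1 + b / γ : ℝ) : EReal) ∧
      1 + b / γ < b ∧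
      ((b : ℝ) : EReal)
        ≤ limsup (fun n : ℕ =>
            ((Real.log (birkSum (rot θ) (fun z => ‖z‖ ^ (-b)) n x) /
              Real.log n : ℝ) : EReal)) atTop := by
  have hbdd : BddBelow (dioSet θ) := ⟨1, fun s hs => one_le_of_mem_dioSet θ hθ s hs⟩
  have hγ1 : 1 ≤ γ := by
    rw [hγ]
    exact le_csInf hfin fun s hs => one_le_of_mem_dioSet θ hθ s hs
  have hγ0 : 0 < γ := by linarith
  have hmid : 1 + b / γ < b := by
    have h1 := mul_lt_mul_of_pos_left hbγ (show 0 < b by linarith)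
    have h2 : b * (1 / γ) = b / γ := by ring
    have h3 : b * (1 - 1 / b) = b - 1 := by
      have : b ≠ 0 := by linarith
      field_simp
    linarith
  -- bounds along the sequence `δ = 1/(m+3)`
  have hae : ∀ᵐ x ∂(volume : Measure (AddCircle (1 : ℝ))), ∀ m : ℕ,
      liminf (fun n : ℕ =>
          ((Real.log (birkSum (rot θ) (fun z => ‖z‖ ^ (-b)) n x) /
            Real.log n : ℝ) : EReal)) atTop
        ≤ ((1 + (1 + 1 / ((m : ℝ) + 1) / 3) * b / (γ - 2 * (1 / ((m : ℝ) + 1) / 3)) : ℝ)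
            : EReal) := by
    rw [ae_all_iff]
    intro m
    have hd0 : 0 < 1 / ((m : ℝ) + 1) := by positivity
    have hd1 : 1 / ((m : ℝ) + 1) ≤ 1 := by
      rw [div_le_one (by positivity)]
      have : (0 : ℝ) ≤ m := by positivity
      linarith
    set d := 1 / ((m : ℝ) + 1) / 3 with hd
    have hnot : γ - d ∉ dioSet θ :=
      notMem_of_lt_csInf (by rw [← hγ]; linarith) hbdd
    have h := liminf_part θ (γ - d) (γ - 2 * d) hnot (by linarith) (by linarith) b hb
    have e : γ - d - (γ - 2 * d) = d := by ring
    rwa [e] at h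
  filter_upwards [hae, ae_orbit_ne_zero θ] with x hx1 hx2
  refine ⟨?_, hmid, limsup_part θ hθ b hb x hx2⟩
  refine ge_of_tendsto' (x := (atTop : Filter ℕ)) ((continuous_coe_real_ereal.tendsto (1 + b / γ)).comp ?_) hx1
  have h0 : Tendsto (fun m : ℕ => 1 / ((m : ℝ) + 1) / 3) atTop (nhds 0) := by
    simpa using (tendsto_one_div_add_atTop_nhds_zero_nat (𝕜 := ℝ)).div_const 3
  have h1 := ((h0.const_add 1).mul_const b).div ((h0.const_mul 2).const_sub γ)
    (by simpa using hγ0.ne')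
  simpa using h1.const_add 1
end
end

section
/- Let θ be an irrational number of Diophantine type γ = γ(θ) < ∞ and β > 0. Let F : [0,1] × S¹ → [0,1] × S¹ be the skew product F(x,t) = (T(x), t + θ·η(x)), where T(x) = 2x mod 1, S¹ = ℝ/ℤ, and η = 1_{[1/2,1]} is the indicator function of [1/2,1]; F preserves the product of Lebesgue measures. Consider the observable ψ̃(x,t) = d(t,0)^{−β}, where d is the standard metric on S¹. Then for Lebesgue-almost every (x,t) ∈ [0,1] × S¹, liminf_{n→∞} log S_n^{ψ̃}(x,t)/log n ≤ 2 + β/γ and limsup_{n→∞} log S_n^{ψ̃}(x,t)/log n ≥ β, where S_n^{ψ̃}(x,t) = Σ_{k=0}^{n−1} ψ̃(F^k(x,t)). -/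
open MeasureTheory Filter Set Real

noncomputable section

/-- The skew product `F(x,t) = (2x mod 1, t + θ·1_{[1/2,1]}(x))` on
`[0,1] × S¹`. -/
def skew (θ : ℝ) (p : ℝ × AddCircle (1 : ℝ)) : ℝ × AddCircle (1 : ℝ) :=
  (Int.fract (2 * p.1),
    p.2 + ((Set.indicator (Set.Icc (1 / 2 : ℝ) 1) (fun _ => θ) p.1 : ℝ) :
      AddCircle (1 : ℝ)))

/-- The doubling map. -/
def dbl (x : ℝ) : ℝ := Int.fract (2 * x)

open Classical in
/-- Number of digits one among the first `k` binary digits. -/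
def ones (k : ℕ) (x : ℝ) : ℕ :=
  ((Finset.range k).filter (fun i => dbl^[i] x ∈ Set.Icc (1 / 2 : ℝ) 1)).card

lemma ones_zero (x : ℝ) : ones 0 x = 0 := by simp [ones]

open Classical in
lemma ones_succ (k : ℕ) (x : ℝ) :
    ones (k + 1) x = ones k x + if dbl^[k] x ∈ Set.Icc (1 / 2 : ℝ) 1 then 1 else 0 := by
  unfold ones
  rw [Finset.range_add_one, Finset.filter_insert]
  split_ifs with h
  · rw [Finset.card_insert_of_notMem (by simp)]
  · rfl

lemma ones_le (k : ℕ) (x : ℝ) : ones k x ≤ k := by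
  unfold ones
  exact (Finset.card_filter_le _ _).trans (by simp)

lemma skew_iter (θ x : ℝ) (t : AddCircle (1 : ℝ)) (k : ℕ) :
    (skew θ)^[k] (x, t) = (dbl^[k] x, t + (((ones k x : ℝ) * θ : ℝ) : AddCircle (1 : ℝ))) := by
  induction k with
  | zero => simp [ones_zero]
  | succ k ih =>
    rw [Function.iterate_succ_apply', ih, ones_succ, Function.iterate_succ_apply']
    unfold skew
    refine Prod.ext rfl ?_
    simp only [Set.indicator]
    split_ifs with h
    · rw [add_assoc, ← AddCircle.coe_add]; congr 2; push_cast; ring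
    · simp

/-- every value below `ones n x` is attained before `n`. -/
lemma ones_ivt (x : ℝ) (n : ℕ) : ∀ j < ones n x, ∃ k < n, ones k x = j := by
  induction n with
  | zero => intro j hj; simp [ones_zero] at hj
  | succ n ih =>
    intro j hj
    rw [ones_succ] at hj
    by_cases h : j < ones n x
    · obtain ⟨k, hk, h⟩ := ih j h
      exact ⟨k, by omega, h⟩
    · refine ⟨n, by omega, ?_⟩
      split_ifs at hj <;> omega

lemma dbl_iter {x : ℝ} (hx : x ∈ Set.Ico (0 : ℝ) 1) (k : ℕ) :
    dbl^[k] x = Int.fract (2 ^ k * x) := by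
  induction k with
  | zero => simp [Int.fract_eq_self.2 hx]
  | succ k ih =>
    rw [Function.iterate_succ_apply', ih, dbl, Int.fract_eq_fract]
    refine ⟨- (2 * ⌊2 ^ k * x⌋), ?_⟩
    have := Int.self_sub_floor (2 ^ k * x)
    rw [← this]; push_cast; ring

lemma dbl_run (L : ℕ) : ∀ y ∈ Set.Ico (0 : ℝ) 1,
    (∀ i < L, dbl^[i] y ∉ Set.Icc (1 / 2 : ℝ) 1) → y < 1 / 2 ^ L := by
  induction L with
  | zero => intro y hy _; simpa using hy.2
  | succ L ih =>
    intro y hy h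
    have h0 := h 0 (by omega)
    simp only [Function.iterate_zero, id, Set.mem_Icc, not_and_or, not_le] at h0
    have hy2 : y < 1 / 2 := by
      rcases h0 with h | h
      · exact h
      · linarith [hy.2]
    have e : dbl y = 2 * y := Int.fract_eq_self.2 ⟨by linarith [hy.1], by linarith⟩
    have := ih (2 * y) ⟨by linarith [hy.1], by linarith⟩ (by
      intro i hi
      rw [← e, ← Function.iterate_succ_apply]
      exact h (i + 1) (by omega))
    rw [pow_succ, ← div_div]
    linarith

/-- bad set: some block of length `L` among the first `m` ones has only zeros -/
lemma ones_blocks (x : ℝ) (L : ℕ) (m : ℕ)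
    (h : ∀ i < m, ∃ r < L, dbl^[i * L + r] x ∈ Set.Icc (1 / 2 : ℝ) 1) : m ≤ ones (m * L) x := by
  classical
  choose! r hr hr' using h
  unfold ones
  have : ((Finset.range m).image (fun i => i * L + r i)).card = m := by
    rw [Finset.card_image_of_injOn, Finset.card_range]
    intro i hi j hj hij
    simp only [Finset.coe_range, Set.mem_Iio] at hi hj
    simp only at hij
    have h1 := hr i hi
    have h2 := hr j hj
    have a : (i * L + r i) / L = i := by
      rw [mul_comm, Nat.mul_add_div (by omega), Nat.div_eq_of_lt h1, add_zero]
    have b : (j * L + r j) / L = j := by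
      rw [mul_comm, Nat.mul_add_div (by omega), Nat.div_eq_of_lt h2, add_zero]
    rw [← a, ← b, hij]
  nth_rw 1 [← this]
  apply Finset.card_le_card
  intro k hk
  simp only [Finset.mem_image, Finset.mem_range] at hk
  obtain ⟨i, hi, rfl⟩ := hk
  simp only [Finset.mem_filter, Finset.mem_range]
  refine ⟨?_, hr' i hi⟩
  have := hr i hi
  calc i * L + r i < (i + 1) * L := by rw [add_mul]; omega
    _ ≤ m * L := Nat.mul_le_mul_right _ hi

lemma vol_block (k L : ℕ) :
    volume {x : ℝ | x ∈ Set.Ico (0 : ℝ) 1 ∧ Int.fract (2 ^ k * x) < 1 / 2 ^ L}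
      ≤ ENNReal.ofReal (1 / 2 ^ L) := by
  have hsub : {x : ℝ | x ∈ Set.Ico (0 : ℝ) 1 ∧ Int.fract (2 ^ k * x) < 1 / 2 ^ L} ⊆
      ⋃ a ∈ Finset.range (2 ^ k),
        Set.Icc ((a : ℝ) / 2 ^ k) ((a : ℝ) / 2 ^ k + 1 / 2 ^ L / 2 ^ k) := by
    rintro x ⟨hx, hf⟩
    have hp : (0 : ℝ) < 2 ^ k := by positivity
    have hnn : (0 : ℝ) ≤ 2 ^ k * x := mul_nonneg hp.le hx.1
    simp only [Set.mem_iUnion, Finset.mem_range]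
    refine ⟨⌊2 ^ k * x⌋₊, ?_, ?_, ?_⟩
    · rw [Nat.floor_lt hnn]; push_cast
      nlinarith [hx.2]
    · rw [div_le_iff₀ hp, mul_comm x]
      exact Nat.floor_le hnn
    · rw [← add_div, le_div_iff₀ hp, mul_comm x]
      have h1 := Int.floor_add_fract (2 ^ k * x)
      have h2 : ((⌊2 ^ k * x⌋₊ : ℕ) : ℝ) = ((⌊2 ^ k * x⌋ : ℤ) : ℝ) := by
        exact natCast_floor_eq_intCast_floor hnn
      rw [h2]; linarith
  refine (measure_mono hsub).trans ((measure_biUnion_finset_le _ _).trans ?_)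
  simp only [Real.volume_Icc, add_sub_cancel_left, Finset.sum_const, Finset.card_range]
  rw [← ENNReal.ofReal_nsmul]
  apply le_of_eq
  congr 1
  rw [nsmul_eq_mul]; push_cast; field_simp

/-- Bad set of `x` at scale `m`. -/
def badX (m L : ℕ) : Set ℝ :=
  ⋃ i ∈ Finset.range m,
    {x : ℝ | x ∈ Set.Ico (0 : ℝ) 1 ∧ Int.fract (2 ^ (i * L) * x) < 1 / 2 ^ L}

lemma vol_badX (m L : ℕ) : volume (badX m L) ≤ ENNReal.ofReal (m * (1 / 2 ^ L)) := by
  refine (measure_biUnion_finset_le _ _).trans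
    ((Finset.sum_le_sum (fun i _ => vol_block (i * L) L)).trans ?_)
  simp only [Finset.sum_const, Finset.card_range]
  rw [← ENNReal.ofReal_nsmul, nsmul_eq_mul]

lemma ones_of_not_bad {x : ℝ} (hx : x ∈ Set.Ico (0 : ℝ) 1) {m L : ℕ} (h : x ∉ badX m L) :
    m ≤ ones (m * L) x := by
  apply ones_blocks
  intro i hi
  by_contra! hc
  apply h
  simp only [badX, Set.mem_iUnion, Finset.mem_range]
  refine ⟨i, hi, hx, ?_⟩
  apply dbl_run L _ ⟨Int.fract_nonneg _, Int.fract_lt_one _⟩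
  intro r hr
  rw [← dbl_iter hx, ← Function.iterate_add_apply, add_comm]
  exact hc r hr

lemma ae_frequently {X : Type*} [MeasurableSpace X] (μ : Measure X) (P : ℕ → Prop)
    (hP : ∃ᶠ q in atTop, P q) (B : ℕ → Set X)
    (hB : Tendsto (fun q => μ (B q)) atTop (nhds 0)) :
    ∀ᵐ x ∂μ, ∃ᶠ q in atTop, P q ∧ x ∉ B q := by
  have key : ∀ N : ℕ, μ {x | ∀ q ≥ N, P q → x ∈ B q} = 0 := by
    intro N
    by_contra hne
    have hpos := pos_iff_ne_zero.2 hne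
    have h1 := (hB.eventually (gt_mem_nhds hpos)).and (eventually_ge_atTop N)
    obtain ⟨q, hq, h2, h3⟩ := (hP.and_eventually h1).exists
    exact absurd h2 (not_lt.2 (measure_mono (fun x hx => hx q h3 hq)))
  have : ∀ᵐ x ∂μ, ∀ N : ℕ, ¬ ∀ q ≥ N, P q → x ∈ B q := by
    rw [ae_all_iff]
    intro N
    rw [ae_iff]
    simpa using key N
  filter_upwards [this] with x hx
  rw [frequently_atTop]
  intro N
  have := hx N
  push Not at this
  obtain ⟨q, h1, h2, h3⟩ := this
  exact ⟨q, h1, h2, h3⟩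

lemma freq_dirichlet (θ : ℝ) (hθ : Irrational θ) :
    ∃ᶠ q : ℕ in atTop, ∃ p : ℤ, IsCoprime p (q : ℤ) ∧ |θ - p / q| < 1 / (q : ℝ) ^ 2 := by
  have hinf := Real.infinite_rat_abs_sub_lt_one_div_den_sq_of_irrational hθ
  rw [frequently_atTop]
  intro N
  by_contra! hc
  apply hinf
  let M : ℤ := ⌈(N : ℝ) * (|θ| + 1)⌉
  refine Set.Finite.subset (((Set.finite_Icc (-M) M).prod (Set.finite_Iic N)).image
    (fun z : ℤ × ℕ => (z.1 : ℚ) / z.2)) ?_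
  intro r hr
  simp only [Set.mem_ofPred_eq] at hr
  have hden : r.den < N := by
    by_contra! hn
    have := hc r.den hn r.num (by
      rw [Int.isCoprime_iff_gcd_eq_one]; simpa [Int.gcd] using r.reduced)
    rw [Rat.cast_def] at hr
    linarith
  have hd1 : (1 : ℝ) ≤ r.den := by exact_mod_cast r.den_pos
  refine ⟨(r.num, r.den), ⟨?_, hden.le⟩, Rat.num_div_den r⟩
  have h1 : |(r : ℝ)| ≤ |θ| + 1 := by
    have h2 : 1 / (r.den : ℝ) ^ 2 ≤ 1 := by
      rw [div_le_one (by positivity)]; nlinarith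
    have h3 := abs_sub_abs_le_abs_sub (r : ℝ) θ
    rw [abs_sub_comm] at h3
    linarith
  have h2 : |(r.num : ℝ)| ≤ N * (|θ| + 1) := by
    have e : (r.num : ℝ) = r.den * r := by
      have : (r.den : ℝ) ≠ 0 := by positivity
      conv_rhs => rw [Rat.cast_def]
      field_simp
    rw [e, abs_mul, Nat.abs_cast]
    have : (r.den : ℝ) ≤ N := by exact_mod_cast hden.le
    gcongr
  have h3 : ((|r.num| : ℤ) : ℝ) ≤ (M : ℝ) := by
    push_cast
    exact h2.trans (Int.le_ceil _)
  have h4 : |r.num| ≤ M := by exact_mod_cast h3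
  exact abs_le.1 h4

lemma norm_coe_le (x : ℝ) : ‖(x : AddCircle (1 : ℝ))‖ ≤ |x| := by
  rw [AddCircle.norm_eq]
  simpa using round_le x 0

lemma coe_int_zero (s : ℤ) : ((s : ℝ) : AddCircle (1 : ℝ)) = 0 := by
  rw [AddCircle.coe_eq_zero_iff]; exact ⟨s, by simp⟩

lemma dense_orbit (θ : ℝ) (q : ℕ) (hq : 0 < q) (p : ℤ) (hc : IsCoprime p (q : ℤ))
    (hp : |θ - p / q| < 1 / (q : ℝ) ^ 2) (t : AddCircle (1 : ℝ)) :
    ∃ j < q, ‖t + (((j : ℝ) * θ : ℝ) : AddCircle (1 : ℝ))‖ ≤ 2 / q := by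
  obtain ⟨t, rfl⟩ := QuotientAddGroup.mk_surjective t
  change ∃ j < q, ‖(t : AddCircle (1 : ℝ)) + (((j : ℝ) * θ : ℝ) : AddCircle (1 : ℝ))‖ ≤ 2 / q
  have hq' : (0 : ℝ) < q := by exact_mod_cast hq
  have hqz : (0 : ℤ) < q := by exact_mod_cast hq
  set m : ℤ := round (-t * q) with hm
  obtain ⟨u, v, huv⟩ := hc
  set z : ℤ := (u * m) % q with hz
  have hz0 : 0 ≤ z := Int.emod_nonneg _ hqz.ne'
  have hz1 : z < q := Int.emod_lt_of_pos _ hqz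
  obtain ⟨j, hj⟩ := Int.eq_ofNat_of_zero_le hz0
  have hjq : j < q := by omega
  refine ⟨j, hjq, ?_⟩
  -- j * p = m + q * s
  obtain ⟨s, hs⟩ : ∃ s : ℤ, (j : ℤ) * p = m + q * s := by
    have h1 : z = u * m - q * (u * m / q) := by
      rw [hz, Int.emod_def]
    refine ⟨- v * m - (u * m / q) * p, ?_⟩
    rw [← hj, h1]
    linear_combination m * huv
  have hsR : (j : ℝ) * p = m + q * s := by exact_mod_cast hs
  have e : t + (j : ℝ) * θ = (t + m / q + j * (θ - p / q)) + (s : ℝ) := by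
    have : (j : ℝ) * (p / q) = m / q + s := by
      rw [← mul_div_assoc, hsR]; field_simp
    linear_combination this
  rw [← AddCircle.coe_add, e, AddCircle.coe_add, coe_int_zero, add_zero]
  refine (norm_coe_le _).trans ?_
  have a1 : |t + m / q| ≤ 1 / q := by
    have := abs_sub_round (-t * (q : ℝ))
    have e2 : t + m / q = -((-t * q - m) / q) := by field_simp; ring
    rw [e2, abs_neg, abs_div, Nat.abs_cast]
    gcongr
    rw [hm]; linarith
  have a2 : |(j : ℝ) * (θ - p / q)| ≤ 1 / q := by
    rw [abs_mul, Nat.abs_cast]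
    have : (j : ℝ) ≤ q := by exact_mod_cast hjq.le
    calc (j : ℝ) * |θ - p / q| ≤ q * (1 / (q : ℝ) ^ 2) := by gcongr
      _ = 1 / q := by field_simp
  calc _ ≤ |t + m / q| + |(j : ℝ) * (θ - p / q)| := abs_add_le _ _
    _ ≤ 1 / q + 1 / q := add_le_add a1 a2
    _ = 2 / q := by ring

lemma natDist_eq (x : ℝ) : natDist x = ‖(x : AddCircle (1 : ℝ))‖ := by
  rw [AddCircle.norm_eq]; simp [natDist]

lemma dioSet_ge (θ : ℝ) (hθ : Irrational θ) (a : ℝ) (ha : a ∈ dioSet θ) : 1 ≤ a := by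
  obtain ⟨c, hc, h⟩ := ha
  by_contra! hlt
  have hlim : Tendsto (fun q : ℕ => (q : ℝ) ^ (-(1 - a))) atTop (nhds 0) :=
    (tendsto_rpow_neg_atTop (by linarith)).comp tendsto_natCast_atTop_atTop
  have hev := (h.and (hlim.eventually (gt_mem_nhds hc))).and (eventually_gt_atTop 0)
  obtain ⟨q, ⟨p, -, hp⟩, ⟨h1, h2⟩, h3⟩ := ((freq_dirichlet θ hθ).and_eventually hev).exists
  have hq : (0 : ℝ) < q := by exact_mod_cast h3
  have : natDist (q * θ) ≤ (q : ℝ)⁻¹ := by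
    have e : (q : ℝ) * θ = q * (θ - p / q) + (p : ℝ) := by field_simp; ring
    rw [natDist_eq, e, AddCircle.coe_add, coe_int_zero, add_zero]
    refine (norm_coe_le _).trans ?_
    rw [abs_mul, Nat.abs_cast]
    calc (q : ℝ) * |θ - p / q| ≤ q * (1 / (q : ℝ) ^ 2) := by gcongr
      _ = (q : ℝ)⁻¹ := by field_simp
  have h4 : (q : ℝ) ^ a * natDist (q * θ) ≤ (q : ℝ) ^ (-(1 - a)) := by
    calc _ ≤ (q : ℝ) ^ a * (q : ℝ)⁻¹ := by gcongr
      _ = _ := by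
        rw [← Real.rpow_neg_one, ← Real.rpow_add hq]; congr 1; ring
  linarith

/-- Bad set of `t` at scale `q`. -/
def badT (ε : ℝ) (q : ℕ) : Set (AddCircle (1 : ℝ)) :=
  ⋃ i ∈ Finset.range q,
    Metric.closedBall (-((((i : ℝ) / q : ℝ)) : AddCircle (1 : ℝ))) (2 * (q : ℝ) ^ (-1 - ε))

lemma vol_badT (ε : ℝ) (q : ℕ) (hq : 0 < q) :
    volume (badT ε q) ≤ ENNReal.ofReal (4 * (q : ℝ) ^ (-ε)) := by
  have hq' : (0 : ℝ) < q := by exact_mod_cast hq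
  have h1 : ∀ i ∈ Finset.range q, volume (Metric.closedBall
      (-((((i : ℝ) / q : ℝ)) : AddCircle (1 : ℝ))) (2 * (q : ℝ) ^ (-1 - ε)))
      ≤ ENNReal.ofReal (4 * (q : ℝ) ^ (-1 - ε)) := by
    intro i _
    rw [AddCircle.volume_closedBall]
    apply ENNReal.ofReal_le_ofReal
    refine (min_le_right _ _).trans (le_of_eq ?_)
    ring
  refine (measure_biUnion_finset_le _ _).trans ((Finset.sum_le_sum h1).trans ?_)
  simp only [Finset.sum_const, Finset.card_range]
  rw [← ENNReal.ofReal_nsmul, nsmul_eq_mul]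
  apply ENNReal.ofReal_le_ofReal
  apply le_of_eq
  have : (q : ℝ) ^ (-ε) = q * (q : ℝ) ^ (-1 - ε) := by
    nth_rw 2 [← Real.rpow_one (q : ℝ)]
    rw [← Real.rpow_add hq']; congr 1; ring
  rw [this]; ring

lemma good_T (θ g ε : ℝ) (q : ℕ) (hq : 0 < q) (h : (q : ℝ) ^ g * natDist (q * θ) < 1)
    (t : AddCircle (1 : ℝ)) (ht : t ∉ badT ε q) (j : ℕ) (hj : (j : ℝ) ≤ (q : ℝ) ^ (g - ε)) :
    (q : ℝ) ^ (-1 - ε) ≤ ‖t + (((j : ℝ) * θ : ℝ) : AddCircle (1 : ℝ))‖ := by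
  have hq' : (0 : ℝ) < q := by exact_mod_cast hq
  have hqz : (0 : ℤ) < q := by exact_mod_cast hq
  set p : ℤ := round ((q : ℝ) * θ) with hp
  have hz0 : 0 ≤ ((j : ℤ) * p) % q := Int.emod_nonneg _ hqz.ne'
  have hz1 : ((j : ℤ) * p) % q < q := Int.emod_lt_of_pos _ hqz
  obtain ⟨i, hi⟩ := Int.eq_ofNat_of_zero_le hz0
  set s : ℤ := ((j : ℤ) * p) / q with hs
  have e1 : (j : ℤ) * p = i + q * s := by
    have := Int.emod_add_mul_ediv ((j : ℤ) * p) q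
    rw [hi] at this
    exact this.symm
  have e1R : (j : ℝ) * p = i + q * s := by exact_mod_cast e1
  have hiq : i < q := by omega
  have hd : |θ - p / q| ≤ (q : ℝ) ^ (-g - 1) := by
    have : |θ - p / q| = natDist (q * θ) / q := by
      rw [natDist, ← hp]
      have : θ - p / q = (q * θ - p) / q := by field_simp
      rw [this, abs_div, Nat.abs_cast]
    rw [this, Real.rpow_sub_one hq'.ne', Real.rpow_neg hq'.le]
    gcongr
    rw [← one_div, le_div_iff₀ (by positivity), mul_comm]
    exact h.le
  have he : |(j : ℝ) * (θ - p / q)| ≤ (q : ℝ) ^ (-1 - ε) := by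
    rw [abs_mul, Nat.abs_cast]
    calc (j : ℝ) * |θ - p / q| ≤ (q : ℝ) ^ (g - ε) * (q : ℝ) ^ (-g - 1) := by gcongr
      _ = _ := by rw [← Real.rpow_add hq']; congr 1; ring
  have e2 : (j : ℝ) * θ = (i : ℝ) / q + (j : ℝ) * (θ - p / q) + (s : ℝ) := by
    have : (j : ℝ) * (p / q) = i / q + s := by
      rw [← mul_div_assoc, e1R]; field_simp
    linear_combination this
  rw [e2, AddCircle.coe_add, coe_int_zero, add_zero, AddCircle.coe_add, ← add_assoc]
  have hb : 2 * (q : ℝ) ^ (-1 - ε) < ‖t + (((i : ℝ) / q : ℝ) : AddCircle (1 : ℝ))‖ := by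
    by_contra! hc
    apply ht
    simp only [badT, Set.mem_iUnion, Finset.mem_range]
    refine ⟨i, hiq, ?_⟩
    rw [Metric.mem_closedBall, dist_eq_norm, sub_neg_eq_add]
    exact hc
  have h3 := norm_sub_le (t + (((i : ℝ) / q : ℝ) : AddCircle (1 : ℝ)) +
    (((j : ℝ) * (θ - p / q) : ℝ) : AddCircle (1 : ℝ)))
    (((j : ℝ) * (θ - p / q) : ℝ) : AddCircle (1 : ℝ))
  rw [add_sub_cancel_right] at h3
  have h4 := (norm_coe_le ((j : ℝ) * (θ - p / q))).trans he
  linarith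

lemma part_one (θ : ℝ) (hθ : Irrational θ)
    (γ : ℝ) (hγ : γ = sInf (dioSet θ)) (hfin : (dioSet θ).Nonempty)
    (b : ℝ) (hb : 0 < b) :
    ∀ᵐ t : AddCircle (1 : ℝ), ∀ x : ℝ, ∃ᶠ n : ℕ in atTop,
      Real.log (birkSum (skew θ) (fun q => ‖q.2‖ ^ (-b)) n (x, t)) / Real.log n ≤ 2 + b / γ := by
  have hγ1 : 1 ≤ γ := by
    rw [hγ]; exact le_csInf hfin (dioSet_ge θ hθ)
  have hbdd : BddBelow (dioSet θ) := ⟨1, dioSet_ge θ hθ⟩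
  set ε : ℝ := 1 / (3 * b + 2) with hε
  have hε0 : 0 < ε := by positivity
  have hεe : ε * (3 * b + 2) = 1 := by rw [hε]; field_simp
  set g : ℝ := γ - ε with hg
  have hgε : 0 < g - ε := by nlinarith
  have hfreq : ∃ᶠ q : ℕ in atTop, (q : ℝ) ^ g * natDist (q * θ) < 1 := by
    have hn : g ∉ dioSet θ := fun hm => by
      have := csInf_le hbdd hm
      linarith
    intro hc
    apply hn
    refine ⟨1, one_pos, ?_⟩
    filter_upwards [hc] with q hq
    exact not_lt.1 hq
  have hexp : b * (1 + ε) ≤ (g - ε) * (1 + b / γ) := by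
    have h1 : b / γ ≤ b := div_le_self hb.le hγ1
    have h2 : (g - ε) * (1 + b / γ) = γ + b - 2 * ε - 2 * ε * (b / γ) := by
      rw [hg]; field_simp; ring
    rw [h2]
    nlinarith
  have hB : Tendsto (fun q => (volume : Measure (AddCircle (1 : ℝ))) (badT ε q)) atTop (nhds 0) := by
    have h1 : Tendsto (fun q : ℕ => ENNReal.ofReal (4 * (q : ℝ) ^ (-ε))) atTop (nhds 0) := by
      have h2 : Tendsto (fun q : ℕ => 4 * (q : ℝ) ^ (-ε)) atTop (nhds (4 * 0)) :=
        ((tendsto_rpow_neg_atTop hε0).comp tendsto_natCast_atTop_atTop).const_mul 4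
      have h3 := ENNReal.tendsto_ofReal h2
      simpa using h3
    refine tendsto_of_tendsto_of_tendsto_of_le_of_le' tendsto_const_nhds h1
      (Eventually.of_forall fun _ => zero_le) ?_
    filter_upwards [eventually_gt_atTop 0] with q hq
    exact vol_badT ε q hq
  filter_upwards [ae_frequently volume _ hfreq _ hB] with t ht x
  have hten : Tendsto (fun q : ℕ => ⌈(q : ℝ) ^ (g - ε)⌉₊) atTop atTop :=
    tendsto_nat_ceil_atTop.comp ((tendsto_rpow_atTop hgε).comp tendsto_natCast_atTop_atTop)
  refine hten.frequently ?_
  refine (ht.and_eventually (eventually_gt_atTop 0)).mono ?_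
  rintro q ⟨⟨h1, h2⟩, hq⟩
  have hq' : (0 : ℝ) < q := by exact_mod_cast hq
  set n : ℕ := ⌈(q : ℝ) ^ (g - ε)⌉₊ with hn
  have hnq : (q : ℝ) ^ (g - ε) ≤ n := Nat.le_ceil _
  have hn0 : (0 : ℝ) < n := lt_of_lt_of_le (by positivity) hnq
  have hn1 : (1 : ℝ) ≤ n := by
    have : 0 < n := by exact_mod_cast hn0
    exact_mod_cast this
  have hlog : 0 ≤ Real.log n := Real.log_nonneg hn1
  have hS : birkSum (skew θ) (fun q => ‖q.2‖ ^ (-b)) n (x, t) ≤ (n : ℝ) ^ (2 + b / γ) := by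
    unfold birkSum
    have hterm : ∀ k ∈ Finset.range n, ‖((skew θ)^[k] (x, t)).2‖ ^ (-b) ≤ (q : ℝ) ^ (b * (1 + ε)) := by
      intro k hk
      rw [Finset.mem_range] at hk
      rw [skew_iter]
      have hj : ((ones k x : ℕ) : ℝ) ≤ (q : ℝ) ^ (g - ε) := by
        have h3 : ones k x < n := lt_of_le_of_lt (ones_le k x) hk
        exact (Nat.lt_ceil.1 h3).le
      have h4 := good_T θ g ε q hq h1 t h2 _ hj
      calc _ ≤ ((q : ℝ) ^ (-1 - ε)) ^ (-b) :=
            Real.rpow_le_rpow_of_nonpos (by positivity) h4 (by linarith)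
        _ = _ := by rw [← Real.rpow_mul hq'.le]; congr 1; ring
    calc _ ≤ ∑ k ∈ Finset.range n, (q : ℝ) ^ (b * (1 + ε)) := Finset.sum_le_sum hterm
      _ = n * (q : ℝ) ^ (b * (1 + ε)) := by simp
      _ ≤ n * (q : ℝ) ^ ((g - ε) * (1 + b / γ)) := by
          gcongr
          exact_mod_cast hq
      _ = n * ((q : ℝ) ^ (g - ε)) ^ (1 + b / γ) := by rw [Real.rpow_mul hq'.le]
      _ ≤ n * (n : ℝ) ^ (1 + b / γ) := by gcongr
      _ = _ := by
        nth_rw 1 [← Real.rpow_one (n : ℝ)]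
        rw [← Real.rpow_add hn0]; congr 1; ring
  have hS0 : 0 ≤ birkSum (skew θ) (fun q => ‖q.2‖ ^ (-b)) n (x, t) :=
    Finset.sum_nonneg fun _ _ => by positivity
  have hc0 : 0 ≤ 2 + b / γ := by positivity
  refine div_le_of_le_mul₀ hlog hc0 ?_
  rcases hS0.eq_or_lt with h0 | h0
  · rw [← h0, Real.log_zero]; positivity
  · rw [← Real.log_rpow hn0]
    exact Real.log_le_log h0 hS

/-- block length -/
def blk (q : ℕ) : ℕ := ⌈4 * Real.log q⌉₊

lemma badX_tendsto : Tendsto (fun q => volume (badX q (blk q))) atTop (nhds 0) := by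
  have h1 : Tendsto (fun q : ℕ => ENNReal.ofReal ((q : ℝ)⁻¹)) atTop (nhds 0) := by
    have h3 := ENNReal.tendsto_ofReal (tendsto_inv_atTop_nhds_zero_nat (𝕜 := ℝ))
    simpa using h3
  refine tendsto_of_tendsto_of_tendsto_of_le_of_le' tendsto_const_nhds h1
      (Eventually.of_forall fun _ => zero_le) ?_
  filter_upwards [eventually_gt_atTop 0] with q hq
  have hq' : (1 : ℝ) ≤ q := by exact_mod_cast hq
  have hl := Real.log_nonneg hq'
  refine (vol_badX _ _).trans (ENNReal.ofReal_le_ofReal ?_)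
  have h2 : (q : ℝ) ^ 2 ≤ 2 ^ (blk q) := by
    rw [← Real.log_le_log_iff (by positivity) (by positivity), Real.log_pow, Real.log_pow]
    have := Nat.le_ceil (4 * Real.log q)
    have h5 := Real.log_two_gt_d9
    push_cast
    calc 2 * Real.log q ≤ (4 * Real.log q) * Real.log 2 := by nlinarith
      _ ≤ _ := by unfold blk; gcongr
  calc (q : ℝ) * (1 / 2 ^ blk q) ≤ q * (1 / (q : ℝ) ^ 2) := by gcongr
    _ = (q : ℝ)⁻¹ := by field_simp

lemma ratio_ev (b b' : ℝ) (hb : 0 < b) (hb' : b' < b) :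
    ∀ᶠ q : ℕ in atTop, 1 < ((q * blk q : ℕ) : ℝ) ∧
      b' * Real.log ((q * blk q : ℕ) : ℝ) ≤ b * Real.log ((q : ℝ) / 2) := by
  -- choose δ
  set c : ℝ := max b' (b / 2) with hc
  have hc0 : 0 < c := lt_of_lt_of_le (by linarith) (le_max_right _ _)
  have hcb : c < b := max_lt hb' (by linarith)
  set δ : ℝ := (b - c) / (2 * c) with hδ
  have hδ0 : 0 < δ := div_pos (by linarith) (by linarith)
  have hδc : c * δ = (b - c) / 2 := by rw [hδ]; field_simp
  have h1 : ∀ᶠ q : ℕ in atTop, (blk q : ℝ) ≤ (q : ℝ) ^ δ := by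
    have h2 := (isLittleO_log_rpow_atTop hδ0).bound (show (0 : ℝ) < 1 / 8 by norm_num)
    have h3 := tendsto_natCast_atTop_atTop (R := ℝ) |>.eventually h2
    have h4 := ((tendsto_rpow_atTop hδ0).comp (tendsto_natCast_atTop_atTop (R := ℝ))).eventually_ge_atTop 2
    filter_upwards [h3, h4, eventually_gt_atTop 0] with q a1 a2 a3
    have hq' : (1 : ℝ) ≤ q := by exact_mod_cast a3
    have hl := Real.log_nonneg hq'
    have := Nat.ceil_lt_add_one (show 0 ≤ 4 * Real.log q by positivity)
    simp only [Function.comp] at a2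
    rw [Real.norm_of_nonneg hl, Real.norm_of_nonneg (by positivity)] at a1
    unfold blk
    linarith
  have h5 : ∀ᶠ q : ℕ in atTop, b * Real.log 2 ≤ (b - c) / 2 * Real.log q :=
    ((Real.tendsto_log_atTop.comp (tendsto_natCast_atTop_atTop (R := ℝ))).const_mul_atTop
      (show 0 < (b - c) / 2 by linarith)).eventually_ge_atTop _
  filter_upwards [h1, h5, eventually_ge_atTop 2] with q a1 a2 a3
  have hq : (2 : ℝ) ≤ q := by exact_mod_cast a3
  have hlq : 0 < Real.log q := Real.log_pos (by linarith)
  have hblk : 0 < blk q := Nat.ceil_pos.2 (by positivity)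
  have hblk' : (0 : ℝ) < blk q := by exact_mod_cast hblk
  have hgt : 1 < ((q * blk q : ℕ) : ℝ) := by
    have : 1 < q * blk q := by nlinarith
    exact_mod_cast this
  refine ⟨hgt, ?_⟩
  have hl := Real.log_pos hgt
  calc b' * Real.log ((q * blk q : ℕ) : ℝ) ≤ c * Real.log ((q * blk q : ℕ) : ℝ) := by
        gcongr; exact le_max_left _ _
    _ = c * (Real.log q + Real.log (blk q)) := by
        push_cast; rw [Real.log_mul (by positivity) (by positivity)]
    _ ≤ c * (Real.log q + δ * Real.log q) := by
        gcongr
        rw [← Real.log_rpow (by positivity)]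
        exact Real.log_le_log hblk' a1
    _ = (b + c) / 2 * Real.log q := by linear_combination (Real.log q) * hδc
    _ ≤ b * Real.log ((q : ℝ) / 2) := by
        rw [Real.log_div (by positivity) (by norm_num)]
        linarith

lemma part_two (θ : ℝ) (hθ : Irrational θ) (b : ℝ) (hb : 0 < b) :
    ∀ᵐ x ∂(volume.restrict (Set.Icc (0 : ℝ) 1)), ∀ t : AddCircle (1 : ℝ),
      (∀ j : ℕ, t + (((j : ℝ) * θ : ℝ) : AddCircle (1 : ℝ)) ≠ 0) → ∀ b' < b,
      ∃ᶠ n : ℕ in atTop,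
      b' ≤ Real.log (birkSum (skew θ) (fun q => ‖q.2‖ ^ (-b)) n (x, t)) / Real.log n := by
  have hB : Tendsto (fun q => (volume.restrict (Set.Ico (0 : ℝ) 1)) (badX q (blk q)))
      atTop (nhds 0) :=
    tendsto_of_tendsto_of_tendsto_of_le_of_le tendsto_const_nhds badX_tendsto
      (fun _ => zero_le) (fun _ => Measure.restrict_apply_le _ _)
  rw [← restrict_Ico_eq_restrict_Icc]
  filter_upwards [ae_frequently _ _ (freq_dirichlet θ hθ) _ hB,
    ae_restrict_mem measurableSet_Ico] with x hx hx01 t ht b' hb'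
  have hten : Tendsto (fun q : ℕ => q * blk q) atTop atTop := by
    refine tendsto_atTop_mono' _ ?_ tendsto_id
    filter_upwards [eventually_ge_atTop 2] with q hq
    have hq' : (1 : ℝ) < q := by exact_mod_cast hq
    have hblk : 0 < blk q := Nat.ceil_pos.2 (by have := Real.log_pos hq'; positivity)
    exact Nat.le_mul_of_pos_right _ hblk
  refine hten.frequently ?_
  refine (hx.and_eventually ((ratio_ev b b' hb hb').and (eventually_gt_atTop 0))).mono ?_
  rintro q ⟨⟨⟨p, hc, hp⟩, hbad⟩, ⟨hgt, hle⟩, hq⟩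
  have hq' : (0 : ℝ) < q := by exact_mod_cast hq
  obtain ⟨j, hj, hnorm⟩ := dense_orbit θ q hq p hc hp t
  have hones := ones_of_not_bad hx01 hbad
  obtain ⟨k, hk, hkj⟩ := ones_ivt x _ j (lt_of_lt_of_le hj hones)
  have hpos : 0 < ‖t + (((j : ℝ) * θ : ℝ) : AddCircle (1 : ℝ))‖ := norm_pos_iff.2 (ht j)
  have hS : ((q : ℝ) / 2) ^ b ≤ birkSum (skew θ) (fun q => ‖q.2‖ ^ (-b)) (q * blk q) (x, t) := by
    have h1 : ‖((skew θ)^[k] (x, t)).2‖ ^ (-b) ≤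
        birkSum (skew θ) (fun q => ‖q.2‖ ^ (-b)) (q * blk q) (x, t) :=
      Finset.single_le_sum (f := fun k => ‖((skew θ)^[k] (x, t)).2‖ ^ (-b))
        (fun _ _ => by positivity) (Finset.mem_range.2 hk)
    refine le_trans ?_ h1
    rw [skew_iter, hkj]
    calc ((q : ℝ) / 2) ^ b = (2 / (q : ℝ)) ^ (-b) := by
          rw [Real.rpow_neg (by positivity), ← Real.inv_rpow (by positivity), inv_div]
      _ ≤ _ := Real.rpow_le_rpow_of_nonpos hpos hnorm (by linarith)
  rw [le_div_iff₀ (Real.log_pos hgt)]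
  refine hle.trans ?_
  rw [← Real.log_rpow (by positivity)]
  exact Real.log_le_log (by positivity) hS

/-- Proposition: oscillation bounds for Birkhoff sums of the infinite
observable `ψ̃(x,t) = d(t,0)^{−β}` on the skew product over the doubling map
with rotation angle `θ` of Diophantine type `γ`. -/
theorem skew_product_oscillating_birkhoff_sums
    (θ : ℝ) (hθ : Irrational θ)
    (hfin : (dioSet θ).Nonempty)
    (γ : ℝ) (hγ : γ = sInf (dioSet θ))
    (b : ℝ) (hb : 0 < b) :
    ∀ᵐ p ∂((volume.restrict (Set.Icc (0 : ℝ) 1)).prod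
        (volume : Measure (AddCircle (1 : ℝ)))),
      liminf (fun n : ℕ =>
          ((Real.log (birkSum (skew θ) (fun q => ‖q.2‖ ^ (-b)) n p) /
            Real.log n : ℝ) : EReal)) atTop
        ≤ ((2 + b / γ : ℝ) : EReal) ∧
      ((b : ℝ) : EReal)
        ≤ limsup (fun n : ℕ =>
            ((Real.log (birkSum (skew θ) (fun q => ‖q.2‖ ^ (-b)) n p) /
              Real.log n : ℝ) : EReal)) atTop := by
  have hnull : ∀ᵐ t : AddCircle (1 : ℝ),
      ∀ j : ℕ, t + (((j : ℝ) * θ : ℝ) : AddCircle (1 : ℝ)) ≠ 0 := by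
    rw [ae_all_iff]
    intro j
    have hs : (volume : Measure (AddCircle (1 : ℝ)))
        {-(((j : ℝ) * θ : ℝ) : AddCircle (1 : ℝ))} = 0 := by
      rw [← Metric.closedBall_zero, AddCircle.volume_closedBall]
      simp
    filter_upwards [compl_mem_ae_iff.2 hs] with t ht h0
    exact ht (eq_neg_of_add_eq_zero_left h0)
  have hsnd := Measure.quasiMeasurePreserving_snd
    (μ := volume.restrict (Set.Icc (0 : ℝ) 1)) (ν := (volume : Measure (AddCircle (1 : ℝ))))
  have hfst := Measure.quasiMeasurePreserving_fst
    (μ := volume.restrict (Set.Icc (0 : ℝ) 1)) (ν := (volume : Measure (AddCircle (1 : ℝ))))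
  filter_upwards [hsnd.ae (part_one θ hθ γ hγ hfin b hb), hsnd.ae hnull,
    hfst.ae (part_two θ hθ b hb)] with p h1 h2 h3
  obtain ⟨x, t⟩ := p
  constructor
  · refine liminf_le_of_frequently_le' ((h1 x).mono fun n hn => ?_)
    exact_mod_cast hn
  · refine le_of_forall_lt fun c hc => ?_
    obtain ⟨b', hcb, hbb⟩ := EReal.lt_iff_exists_real_btwn.1 hc
    refine hcb.trans_le ?_
    refine le_limsup_of_frequently_le' ((h3 t h2 b' (by exact_mod_cast hbb)).mono fun n hn => ?_)
    exact_mod_cast hn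
end
end
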